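/- arXiv:2512.13964 — 12 statements merged into one kernel-verified Lean document; each statement's English description precedes it below -/
import Mathlib

section
/- Assume cᵢ ≥ 0 and ℓᵢ > 0 for i = 1,2,3, the ordering condition (Ω′), c₃/ℓ₃ < 1, c₁/ℓ₁ + c₂/ℓ₂ + c₃/ℓ₃ ≥ 1, and c₂/ℓ₂ + c₃/ℓ₃ < 1 + c₁/ℓ₁. Then Vol₄(P_H(c,ℓ)) = (4/3)·ℓ₁²ℓ₂²ℓ₃²·(c₁/ℓ₁ + c₂/ℓ₂ + c₃/ℓ₃ + 7). -/
open MeasureTheory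

/-- The convex hull of the graph of the trilinear monomial `x₁x₂x₃` over the box
`[c₁-ℓ₁, c₁+ℓ₁] × [c₂-ℓ₂, c₂+ℓ₂] × [c₃-ℓ₃, c₃+ℓ₃]`, viewed in `ℝ⁴`. -/
noncomputable def PH (c₁ c₂ c₃ ℓ₁ ℓ₂ ℓ₃ : ℝ) : Set (Fin 4 → ℝ) :=
  convexHull ℝ {p : Fin 4 → ℝ | ∃ x₁ x₂ x₃ : ℝ,
    x₁ ∈ Set.Icc (c₁ - ℓ₁) (c₁ + ℓ₁) ∧ x₂ ∈ Set.Icc (c₂ - ℓ₂) (c₂ + ℓ₂) ∧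
    x₃ ∈ Set.Icc (c₃ - ℓ₃) (c₃ + ℓ₃) ∧ p = ![x₁ * x₂ * x₃, x₁, x₂, x₃]}

/-- The point of the graph of the trilinear monomial, shifted by `(a, b, c)`, over `(x, y, z)`. -/
def graphPoint (a b c x y z : ℝ) : Fin 4 → ℝ := ![(x + a) * (y + b) * (z + c), x, y, z]

/-- The concave envelope of `(x + a) * (y + b) * (z + c)` on the cube `[-1, 1]³`. -/
noncomputable def upperEnv (a b c x y z : ℝ) : ℝ :=
  a * b * c + b * c * x + a * c * y + a * b * z + 1 + a * x + b * y + c * z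
    - 4 * (1 - a) * max ((-x + y + z - 1) / 2) 0 - 4 * (1 - b) * max ((x - y + z - 1) / 2) 0
    - 4 * (1 - c) * max ((x + y - z - 1) / 2) 0
    + (a + b + c - 1) * (1 - (x + y + z) + 2 * min x (min y z))

/-- The convex envelope of `(x + a) * (y + b) * (z + c)` on the cube `[-1, 1]³`. -/
noncomputable def lowerEnv (a b c x y z : ℝ) : ℝ :=
  a * b * c + b * c * x + a * c * y + a * b * z - 1 - a * x - b * y - c * z
    + 2 * (1 + a + b + c) * max ((x + y + z - 1) / 2) 0
    + 2 * (1 + a - b - c) * max ((x - y - z - 1) / 2) 0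
    + 2 * (1 - a + b - c) * max ((-x + y - z - 1) / 2) 0
    + 2 * (1 - a - b + c) * max ((-x - y + z - 1) / 2) 0

/-- The region over the cube `[-1, 1]³` between `lowerEnv` and `upperEnv`. -/
def envRegion (a b c : ℝ) : Set (Fin 4 → ℝ) :=
  {p | (p 1 ∈ Set.Icc (-1) 1 ∧ p 2 ∈ Set.Icc (-1) 1 ∧ p 3 ∈ Set.Icc (-1) 1) ∧
    lowerEnv a b c (p 1) (p 2) (p 3) ≤ p 0 ∧ p 0 ≤ upperEnv a b c (p 1) (p 2) (p 3)}

theorem max_zero_convex {s t α β : ℝ} (hα : 0 ≤ α) (hβ : 0 ≤ β) :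
    max (α * s + β * t) 0 ≤ α * max s 0 + β * max t 0 := by
  have h₁ := mul_le_mul_of_nonneg_left (le_max_left s 0) hα
  have h₂ := mul_le_mul_of_nonneg_left (le_max_left t 0) hβ
  have h₃ := mul_nonneg hα (le_max_right s 0)
  have h₄ := mul_nonneg hβ (le_max_right t 0)
  exact max_le (by linarith) (by linarith)

theorem min_concave {s t u s' t' u' α β : ℝ} (hα : 0 ≤ α) (hβ : 0 ≤ β) :
    α * min s (min t u) + β * min s' (min t' u') ≤
      min (α * s + β * s') (min (α * t + β * t') (α * u + β * u')) := by
  refine le_min ?_ (le_min ?_ ?_) <;> gcongr <;> simp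

section Envelopes

variable {a b c : ℝ}

theorem upperEnv_concave (ha : a ≤ 1) (hb : b ≤ 1) (hc : c ≤ 1) (hs : 1 ≤ a + b + c)
    {x y z x' y' z' α β : ℝ} (hα : 0 ≤ α) (hβ : 0 ≤ β) (h : α + β = 1) :
    α * upperEnv a b c x y z + β * upperEnv a b c x' y' z' ≤
      upperEnv a b c (α * x + β * x') (α * y + β * y') (α * z + β * z') := by
  obtain rfl : β = 1 - α := by linarith
  have h₁ := mul_le_mul_of_nonneg_left (max_zero_convex (s := (-x + y + z - 1) / 2)
    (t := (-x' + y' + z' - 1) / 2) hα hβ) (sub_nonneg.2 ha)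
  have h₂ := mul_le_mul_of_nonneg_left (max_zero_convex (s := (x - y + z - 1) / 2)
    (t := (x' - y' + z' - 1) / 2) hα hβ) (sub_nonneg.2 hb)
  have h₃ := mul_le_mul_of_nonneg_left (max_zero_convex (s := (x + y - z - 1) / 2)
    (t := (x' + y' - z' - 1) / 2) hα hβ) (sub_nonneg.2 hc)
  have h₄ := mul_le_mul_of_nonneg_left (min_concave (s := x) (t := y) (u := z)
    (s' := x') (t' := y') (u' := z') hα hβ) (sub_nonneg.2 hs)
  have e₁ : (-(α * x + (1 - α) * x') + (α * y + (1 - α) * y') + (α * z + (1 - α) * z') - 1) / 2 =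
    α * ((-x + y + z - 1) / 2) + (1 - α) * ((-x' + y' + z' - 1) / 2) := by ring
  have e₂ : ((α * x + (1 - α) * x') - (α * y + (1 - α) * y') + (α * z + (1 - α) * z') - 1) / 2 =
    α * ((x - y + z - 1) / 2) + (1 - α) * ((x' - y' + z' - 1) / 2) := by ring
  have e₃ : ((α * x + (1 - α) * x') + (α * y + (1 - α) * y') - (α * z + (1 - α) * z') - 1) / 2 =
    α * ((x + y - z - 1) / 2) + (1 - α) * ((x' + y' - z' - 1) / 2) := by ring
  unfold upperEnv
  rw [e₁, e₂, e₃]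
  linarith

theorem lowerEnv_convex (h₀ : 0 ≤ 1 + a + b + c) (h₁ : 0 ≤ 1 + a - b - c)
    (h₂ : 0 ≤ 1 - a + b - c) (h₃ : 0 ≤ 1 - a - b + c)
    {x y z x' y' z' α β : ℝ} (hα : 0 ≤ α) (hβ : 0 ≤ β) (h : α + β = 1) :
    lowerEnv a b c (α * x + β * x') (α * y + β * y') (α * z + β * z') ≤
      α * lowerEnv a b c x y z + β * lowerEnv a b c x' y' z' := by
  obtain rfl : β = 1 - α := by linarith
  have k₀ := mul_le_mul_of_nonneg_left (max_zero_convex (s := (x + y + z - 1) / 2)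
    (t := (x' + y' + z' - 1) / 2) hα hβ) h₀
  have k₁ := mul_le_mul_of_nonneg_left (max_zero_convex (s := (x - y - z - 1) / 2)
    (t := (x' - y' - z' - 1) / 2) hα hβ) h₁
  have k₂ := mul_le_mul_of_nonneg_left (max_zero_convex (s := (-x + y - z - 1) / 2)
    (t := (-x' + y' - z' - 1) / 2) hα hβ) h₂
  have k₃ := mul_le_mul_of_nonneg_left (max_zero_convex (s := (-x - y + z - 1) / 2)
    (t := (-x' - y' + z' - 1) / 2) hα hβ) h₃
  have e₀ : ((α * x + (1 - α) * x') + (α * y + (1 - α) * y') + (α * z + (1 - α) * z') - 1) / 2 =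
    α * ((x + y + z - 1) / 2) + (1 - α) * ((x' + y' + z' - 1) / 2) := by ring
  have e₁ : ((α * x + (1 - α) * x') - (α * y + (1 - α) * y') - (α * z + (1 - α) * z') - 1) / 2 =
    α * ((x - y - z - 1) / 2) + (1 - α) * ((x' - y' - z' - 1) / 2) := by ring
  have e₂ : (-(α * x + (1 - α) * x') + (α * y + (1 - α) * y') - (α * z + (1 - α) * z') - 1) / 2 =
    α * ((-x + y - z - 1) / 2) + (1 - α) * ((-x' + y' - z' - 1) / 2) := by ring
  have e₃ : (-(α * x + (1 - α) * x') - (α * y + (1 - α) * y') + (α * z + (1 - α) * z') - 1) / 2 =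
    α * ((-x - y + z - 1) / 2) + (1 - α) * ((-x' - y' + z' - 1) / 2) := by ring
  unfold lowerEnv
  rw [e₀, e₁, e₂, e₃]
  linarith

theorem convex_envRegion (ha : a ≤ 1) (hb : b ≤ 1) (hc : c ≤ 1) (hs : 1 ≤ a + b + c)
    (h₁ : 0 ≤ 1 + a - b - c) (h₂ : 0 ≤ 1 - a + b - c) (h₃ : 0 ≤ 1 - a - b + c) :
    Convex ℝ (envRegion a b c) := by
  rintro p ⟨⟨hp₁, hp₂, hp₃⟩, hpl, hpu⟩ q ⟨⟨hq₁, hq₂, hq₃⟩, hql, hqu⟩ α β hα hβ h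
  have hI : Convex ℝ (Set.Icc (-1 : ℝ) 1) := convex_Icc _ _
  refine ⟨⟨hI hp₁ hq₁ hα hβ h, hI hp₂ hq₂ hα hβ h, hI hp₃ hq₃ hα hβ h⟩, ?_, ?_⟩ <;>
    simp only [Pi.add_apply, Pi.smul_apply, smul_eq_mul]
  · exact (lowerEnv_convex (by linarith) h₁ h₂ h₃ hα hβ h).trans <|
      add_le_add (mul_le_mul_of_nonneg_left hpl hα) (mul_le_mul_of_nonneg_left hql hβ)
  · exact le_trans (add_le_add (mul_le_mul_of_nonneg_left hpu hα)
      (mul_le_mul_of_nonneg_left hqu hβ)) (upperEnv_concave ha hb hc hs hα hβ h)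

theorem graphPoint_mem_of_convex {K : Set (Fin 4 → ℝ)} (hK : Convex ℝ K)
    (h : ∀ x ∈ ({-1, 1} : Set ℝ), ∀ y ∈ ({-1, 1} : Set ℝ), ∀ z ∈ ({-1, 1} : Set ℝ),
      graphPoint a b c x y z ∈ K)
    {x y z : ℝ} (hx : x ∈ Set.Icc (-1) 1) (hy : y ∈ Set.Icc (-1) 1) (hz : z ∈ Set.Icc (-1) 1) :
    graphPoint a b c x y z ∈ K := by
  have hweights {t : ℝ} (ht : t ∈ Set.Icc (-1) 1) :
      0 ≤ (1 - t) / 2 ∧ 0 ≤ (1 + t) / 2 ∧ (1 - t) / 2 + (1 + t) / 2 = 1 :=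
    ⟨by linarith [ht.2], by linarith [ht.1], by ring⟩
  have hz' : ∀ x ∈ ({-1, 1} : Set ℝ), ∀ y ∈ ({-1, 1} : Set ℝ), graphPoint a b c x y z ∈ K := by
    intro x hx y hy
    obtain ⟨w₁, w₂, w₃⟩ := hweights hz
    convert hK (h x hx y hy (-1) (by simp)) (h x hx y hy 1 (by simp)) w₁ w₂ w₃ using 1
    ext i; fin_cases i <;> simp [graphPoint] <;> ring
  have hy' : ∀ x ∈ ({-1, 1} : Set ℝ), graphPoint a b c x y z ∈ K := by
    intro x hx
    obtain ⟨w₁, w₂, w₃⟩ := hweights hy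
    convert hK (hz' x hx (-1) (by simp)) (hz' x hx 1 (by simp)) w₁ w₂ w₃ using 1
    ext i; fin_cases i <;> simp [graphPoint] <;> ring
  obtain ⟨w₁, w₂, w₃⟩ := hweights hx
  convert hK (hy' (-1) (by simp)) (hy' 1 (by simp)) w₁ w₂ w₃ using 1
  ext i; fin_cases i <;> simp [graphPoint] <;> ring

theorem graphPoint_mem_envRegion_iff {x y z : ℝ} :
    graphPoint a b c x y z ∈ envRegion a b c ↔
      (x ∈ Set.Icc (-1) 1 ∧ y ∈ Set.Icc (-1) 1 ∧ z ∈ Set.Icc (-1) 1) ∧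
        lowerEnv a b c x y z ≤ (x + a) * (y + b) * (z + c) ∧
        (x + a) * (y + b) * (z + c) ≤ upperEnv a b c x y z :=
  Iff.rfl

theorem graphPoint_vertex_mem_envRegion :
    ∀ x ∈ ({-1, 1} : Set ℝ), ∀ y ∈ ({-1, 1} : Set ℝ), ∀ z ∈ ({-1, 1} : Set ℝ),
      graphPoint a b c x y z ∈ envRegion a b c := by
  rintro x (rfl | rfl) y (rfl | rfl) z (rfl | rfl) <;>
    refine graphPoint_mem_envRegion_iff.2 ⟨by norm_num, le_of_eq ?_, le_of_eq ?_⟩ <;>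
    norm_num [lowerEnv, upperEnv] <;> ring

theorem tetrahedron_mem {K : Set (Fin 4 → ℝ)} (hK : Convex ℝ K) {p q r s : Fin 4 → ℝ}
    (hp : p ∈ K) (hq : q ∈ K) (hr : r ∈ K) (hs : s ∈ K) {α β γ δ : ℝ}
    (hα : 0 ≤ α) (hβ : 0 ≤ β) (hγ : 0 ≤ γ) (hδ : 0 ≤ δ) (h : α + β + γ + δ = 1) :
    α • p + β • q + γ • r + δ • s ∈ K := by
  have := hK.sum_mem (t := Finset.univ) (w := ![α, β, γ, δ]) (z := ![p, q, r, s])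
    (by intro i _; fin_cases i <;> simpa) (by simpa [Fin.sum_univ_four])
    (by intro i _; fin_cases i <;> simpa)
  simpa [Fin.sum_univ_four] using this

theorem upperEnv_mem {K : Set (Fin 4 → ℝ)} (hK : Convex ℝ K)
    (h : ∀ x ∈ ({-1, 1} : Set ℝ), ∀ y ∈ ({-1, 1} : Set ℝ), ∀ z ∈ ({-1, 1} : Set ℝ),
      graphPoint a b c x y z ∈ K)
    {x y z : ℝ} (hx : x ∈ Set.Icc (-1) 1) (hy : y ∈ Set.Icc (-1) 1) (hz : z ∈ Set.Icc (-1) 1) :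
    ![upperEnv a b c x y z, x, y, z] ∈ K := by
  obtain ⟨hx₁, hx₂⟩ := hx
  obtain ⟨hy₁, hy₂⟩ := hy
  obtain ⟨hz₁, hz₂⟩ := hz
  have vppp := h 1 (by simp) 1 (by simp) 1 (by simp)
  have vmpp := h (-1) (by simp) 1 (by simp) 1 (by simp)
  have vpmp := h 1 (by simp) (-1) (by simp) 1 (by simp)
  have vppm := h 1 (by simp) 1 (by simp) (-1) (by simp)
  have vpmm := h 1 (by simp) (-1) (by simp) (-1) (by simp)
  have vmpm := h (-1) (by simp) 1 (by simp) (-1) (by simp)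
  have vmmp := h (-1) (by simp) (-1) (by simp) 1 (by simp)
  have vmmm := h (-1) (by simp) (-1) (by simp) (-1) (by simp)
  have hcases : (x ≤ y ∧ x ≤ z) ∨ (y ≤ x ∧ y ≤ z) ∨ (z ≤ x ∧ z ≤ y) := by grind
  rcases hcases with ⟨h₁, h₂⟩ | ⟨h₁, h₂⟩ | ⟨h₁, h₂⟩
  · have hm : min x (min y z) = x := by grind
    rw [upperEnv, hm, max_eq_right (by linarith : (x - y + z - 1) / 2 ≤ 0),
      max_eq_right (by linarith : (x + y - z - 1) / 2 ≤ 0)]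
    rcases le_total ((-x + y + z - 1) / 2) 0 with h₃ | h₃
    · rw [max_eq_right h₃]
      convert tetrahedron_mem hK vmmm vppp vmpm vmmp (α := (1 + x - y - z) / 2)
        (β := (1 + x) / 2) (γ := (y - x) / 2) (δ := (z - x) / 2) (by linarith) (by linarith)
        (by linarith) (by linarith) (by ring) using 1
      ext i; fin_cases i <;> simp [graphPoint] <;> ring
    · rw [max_eq_left h₃]
      convert tetrahedron_mem hK vmpp vppp vmpm vmmp (α := (-x + y + z - 1) / 2)
        (β := (1 + x) / 2) (γ := (1 - z) / 2) (δ := (1 - y) / 2) (by linarith) (by linarith)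
        (by linarith) (by linarith) (by ring) using 1
      ext i; fin_cases i <;> simp [graphPoint] <;> ring
  · have hm : min x (min y z) = y := by grind
    rw [upperEnv, hm, max_eq_right (by linarith : (-x + y + z - 1) / 2 ≤ 0),
      max_eq_right (by linarith : (x + y - z - 1) / 2 ≤ 0)]
    rcases le_total ((x - y + z - 1) / 2) 0 with h₃ | h₃
    · rw [max_eq_right h₃]
      convert tetrahedron_mem hK vmmm vppp vpmm vmmp (α := (1 + y - x - z) / 2)
        (β := (1 + y) / 2) (γ := (x - y) / 2) (δ := (z - y) / 2) (by linarith) (by linarith)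
        (by linarith) (by linarith) (by ring) using 1
      ext i; fin_cases i <;> simp [graphPoint] <;> ring
    · rw [max_eq_left h₃]
      convert tetrahedron_mem hK vpmp vppp vpmm vmmp (α := (x - y + z - 1) / 2)
        (β := (1 + y) / 2) (γ := (1 - z) / 2) (δ := (1 - x) / 2) (by linarith) (by linarith)
        (by linarith) (by linarith) (by ring) using 1
      ext i; fin_cases i <;> simp [graphPoint] <;> ring
  · have hm : min x (min y z) = z := by grind
    rw [upperEnv, hm, max_eq_right (by linarith : (-x + y + z - 1) / 2 ≤ 0),
      max_eq_right (by linarith : (x - y + z - 1) / 2 ≤ 0)]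
    rcases le_total ((x + y - z - 1) / 2) 0 with h₃ | h₃
    · rw [max_eq_right h₃]
      convert tetrahedron_mem hK vmmm vppp vpmm vmpm (α := (1 + z - x - y) / 2)
        (β := (1 + z) / 2) (γ := (x - z) / 2) (δ := (y - z) / 2) (by linarith) (by linarith)
        (by linarith) (by linarith) (by ring) using 1
      ext i; fin_cases i <;> simp [graphPoint] <;> ring
    · rw [max_eq_left h₃]
      convert tetrahedron_mem hK vppm vppp vpmm vmpm (α := (x + y - z - 1) / 2)
        (β := (1 + z) / 2) (γ := (1 - y) / 2) (δ := (1 - x) / 2) (by linarith) (by linarith)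
        (by linarith) (by linarith) (by ring) using 1
      ext i; fin_cases i <;> simp [graphPoint] <;> ring

theorem lowerEnv_mem {K : Set (Fin 4 → ℝ)} (hK : Convex ℝ K)
    (h : ∀ x ∈ ({-1, 1} : Set ℝ), ∀ y ∈ ({-1, 1} : Set ℝ), ∀ z ∈ ({-1, 1} : Set ℝ),
      graphPoint a b c x y z ∈ K)
    {x y z : ℝ} (hx : x ∈ Set.Icc (-1) 1) (hy : y ∈ Set.Icc (-1) 1) (hz : z ∈ Set.Icc (-1) 1) :
    ![lowerEnv a b c x y z, x, y, z] ∈ K := by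
  obtain ⟨hx₁, hx₂⟩ := hx
  obtain ⟨hy₁, hy₂⟩ := hy
  obtain ⟨hz₁, hz₂⟩ := hz
  have vppp := h 1 (by simp) 1 (by simp) 1 (by simp)
  have vmpp := h (-1) (by simp) 1 (by simp) 1 (by simp)
  have vpmp := h 1 (by simp) (-1) (by simp) 1 (by simp)
  have vppm := h 1 (by simp) 1 (by simp) (-1) (by simp)
  have vpmm := h 1 (by simp) (-1) (by simp) (-1) (by simp)
  have vmpm := h (-1) (by simp) 1 (by simp) (-1) (by simp)
  have vmmp := h (-1) (by simp) (-1) (by simp) 1 (by simp)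
  have vmmm := h (-1) (by simp) (-1) (by simp) (-1) (by simp)
  unfold lowerEnv
  by_cases h₀ : 0 ≤ (x + y + z - 1) / 2
  · rw [max_eq_left h₀, max_eq_right (by linarith : (x - y - z - 1) / 2 ≤ 0),
      max_eq_right (by linarith : (-x + y - z - 1) / 2 ≤ 0),
      max_eq_right (by linarith : (-x - y + z - 1) / 2 ≤ 0)]
    convert tetrahedron_mem hK vppp vmpp vpmp vppm (α := (x + y + z - 1) / 2)
      (β := (1 - x) / 2) (γ := (1 - y) / 2) (δ := (1 - z) / 2) (by linarith) (by linarith)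
      (by linarith) (by linarith) (by ring) using 1
    ext i; fin_cases i <;> simp [graphPoint] <;> ring
  rw [max_eq_right (le_of_not_ge h₀)]
  by_cases h₁ : 0 ≤ (x - y - z - 1) / 2
  · rw [max_eq_left h₁, max_eq_right (by linarith : (-x + y - z - 1) / 2 ≤ 0),
      max_eq_right (by linarith : (-x - y + z - 1) / 2 ≤ 0)]
    convert tetrahedron_mem hK vpmm vmmm vppm vpmp (α := (x - y - z - 1) / 2)
      (β := (1 - x) / 2) (γ := (1 + y) / 2) (δ := (1 + z) / 2) (by linarith) (by linarith)
      (by linarith) (by linarith) (by ring) using 1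
    ext i; fin_cases i <;> simp [graphPoint] <;> ring
  rw [max_eq_right (le_of_not_ge h₁)]
  by_cases h₂ : 0 ≤ (-x + y - z - 1) / 2
  · rw [max_eq_left h₂, max_eq_right (by linarith : (-x - y + z - 1) / 2 ≤ 0)]
    convert tetrahedron_mem hK vmpm vmmm vppm vmpp (α := (-x + y - z - 1) / 2)
      (β := (1 - y) / 2) (γ := (1 + x) / 2) (δ := (1 + z) / 2) (by linarith) (by linarith)
      (by linarith) (by linarith) (by ring) using 1
    ext i; fin_cases i <;> simp [graphPoint] <;> ring
  rw [max_eq_right (le_of_not_ge h₂)]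
  by_cases h₃ : 0 ≤ (-x - y + z - 1) / 2
  · rw [max_eq_left h₃]
    convert tetrahedron_mem hK vmmp vmmm vpmp vmpp (α := (-x - y + z - 1) / 2)
      (β := (1 - z) / 2) (γ := (1 + x) / 2) (δ := (1 + y) / 2) (by linarith) (by linarith)
      (by linarith) (by linarith) (by ring) using 1
    ext i; fin_cases i <;> simp [graphPoint] <;> ring
  rw [max_eq_right (le_of_not_ge h₃)]
  convert tetrahedron_mem hK vmmm vmpp vpmp vppm (α := (1 - x - y - z) / 4)
    (β := (1 - x + y + z) / 4) (γ := (1 + x - y + z) / 4) (δ := (1 + x + y - z) / 4)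
    (by linarith) (by linarith) (by linarith) (by linarith) (by ring) using 1
  ext i; fin_cases i <;> simp [graphPoint] <;> ring

theorem envRegion_subset {K : Set (Fin 4 → ℝ)} (hK : Convex ℝ K)
    (h : ∀ x ∈ ({-1, 1} : Set ℝ), ∀ y ∈ ({-1, 1} : Set ℝ), ∀ z ∈ ({-1, 1} : Set ℝ),
      graphPoint a b c x y z ∈ K) :
    envRegion a b c ⊆ K := by
  rintro p ⟨⟨hx, hy, hz⟩, hl, hu⟩
  have hseg : p 0 ∈ segment ℝ (lowerEnv a b c (p 1) (p 2) (p 3))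
      (upperEnv a b c (p 1) (p 2) (p 3)) := by
    rw [segment_eq_Icc (hl.trans hu)]
    exact ⟨hl, hu⟩
  obtain ⟨α, β, hα, hβ, hαβ, hp⟩ := hseg
  convert hK (lowerEnv_mem hK h hx hy hz) (upperEnv_mem hK h hx hy hz) hα hβ hαβ using 1
  obtain rfl : β = 1 - α := by linarith
  ext i; fin_cases i
  · simpa using hp.symm
  all_goals simp; ring

end Envelopes

section Integrals

open intervalIntegral

theorem hasDerivAt_max_zero_pow (n : ℕ) (t : ℝ) :
    HasDerivAt (fun t : ℝ => max t 0 ^ (n + 2)) ((n + 2) * max t 0 ^ (n + 1)) t := by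
  rcases lt_trichotomy t 0 with ht | rfl | ht
  · rw [max_eq_right ht.le, zero_pow n.succ_ne_zero, mul_zero]
    refine (hasDerivAt_const t (0 : ℝ)).congr_of_eventuallyEq ?_
    filter_upwards [eventually_lt_nhds ht] with s hs
    simp [max_eq_right hs.le]
  · have h : (fun t : ℝ => max t 0 ^ (n + 2)) =O[nhds 0] fun t => ‖t - 0‖ ^ (n + 2) := by
      refine Asymptotics.IsBigO.of_bound 1 (Filter.Eventually.of_forall fun t => ?_)
      rw [one_mul, norm_pow, norm_pow, norm_norm, sub_zero, Real.norm_eq_abs, Real.norm_eq_abs]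
      refine pow_le_pow_left₀ (abs_nonneg _) (abs_le.2 ⟨?_, ?_⟩) _
      · linarith [abs_nonneg t, le_max_right t 0]
      · exact max_le (le_abs_self t) (abs_nonneg t)
    have := (h.hasFDerivAt (by omega)).hasDerivAt
    simpa using this
  · rw [max_eq_left ht.le]
    have h : HasDerivAt (fun t : ℝ => t ^ (n + 2)) ((n + 2) * t ^ (n + 1)) t := by
      simpa using hasDerivAt_pow (n + 2) t
    refine h.congr_of_eventuallyEq ?_
    filter_upwards [eventually_gt_nhds ht] with s hs
    simp [max_eq_left hs.le]

theorem integral_max_zero_pow (n : ℕ) (c p q : ℝ) :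
    ∫ t in p..q, max (c + t) 0 ^ (n + 1) =
      (max (c + q) 0 ^ (n + 2) - max (c + p) 0 ^ (n + 2)) / (n + 2) := by
  have hn : (n + 2 : ℝ) ≠ 0 := by positivity
  rw [integral_eq_sub_of_hasDerivAt (f := fun t => max (c + t) 0 ^ (n + 2) / (n + 2))
    (fun t _ => ?_) (Continuous.intervalIntegrable (by fun_prop) _ _)]
  · ring
  · have := ((hasDerivAt_max_zero_pow n (c + t)).comp_const_add c t).div_const (n + 2 : ℝ)
    rwa [mul_div_cancel_left₀ _ hn] at this

theorem integral_max_zero (c p q : ℝ) :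
    ∫ t in p..q, max (c + t) 0 = (max (c + q) 0 ^ 2 - max (c + p) 0 ^ 2) / 2 := by
  simpa using integral_max_zero_pow 0 c p q

theorem integral_comp_sign_mul (f : ℝ → ℝ) {σ : ℝ} (hσ : σ ∈ ({-1, 1} : Set ℝ)) :
    ∫ t in (-1 : ℝ)..1, f (σ * t) = ∫ t in (-1 : ℝ)..1, f t := by
  rcases hσ with rfl | rfl <;> simp

theorem integral_corner {σ τ υ : ℝ} (hσ : σ ∈ ({-1, 1} : Set ℝ)) (hτ : τ ∈ ({-1, 1} : Set ℝ))
    (hυ : υ ∈ ({-1, 1} : Set ℝ)) :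
    ∫ x in (-1 : ℝ)..1, ∫ y in (-1 : ℝ)..1, ∫ z in (-1 : ℝ)..1,
      max ((σ * x + τ * y + υ * z - 1) / 2) 0 = 1 / 3 := by
  rw [integral_comp_sign_mul (fun x => ∫ y in (-1 : ℝ)..1, ∫ z in (-1 : ℝ)..1,
    max ((x + τ * y + υ * z - 1) / 2) 0) hσ]
  have hz : ∀ x ∈ Set.uIcc (-1 : ℝ) 1, ∀ y ∈ Set.uIcc (-1 : ℝ) 1,
      ∫ z in (-1 : ℝ)..1, max ((x + y + υ * z - 1) / 2) 0 = max (x + y) 0 ^ 2 / 4 := by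
    intro x hx y hy
    rw [Set.uIcc_of_le (by norm_num)] at hx hy
    rw [integral_comp_sign_mul (fun z => max ((x + y + z - 1) / 2) 0) hυ]
    have h (z : ℝ) : max ((x + y + z - 1) / 2) 0 = max (x + y - 1 + z) 0 / 2 := by
      rw [← max_div_div_right (by norm_num), zero_div]; ring_nf
    simp_rw [h]
    rw [intervalIntegral.integral_div, integral_max_zero,
      max_eq_right (by linarith [hx.2, hy.2] : x + y - 1 + -1 ≤ 0)]
    ring_nf
  have hy : ∀ x ∈ Set.uIcc (-1 : ℝ) 1, (∫ y in (-1 : ℝ)..1, ∫ z in (-1 : ℝ)..1,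
      max ((x + τ * y + υ * z - 1) / 2) 0) = (x + 1) ^ 3 / 12 := by
    intro x hx
    rw [integral_comp_sign_mul (fun y => ∫ z in (-1 : ℝ)..1, max ((x + y + υ * z - 1) / 2) 0) hτ,
      intervalIntegral.integral_congr (hz x hx), intervalIntegral.integral_div,
      integral_max_zero_pow 1]
    rw [Set.uIcc_of_le (by norm_num)] at hx
    rw [max_eq_left (by linarith [hx.1]), max_eq_right (by linarith [hx.2])]
    norm_num
    ring
  rw [intervalIntegral.integral_congr hy, intervalIntegral.integral_div,
    integral_comp_add_right (fun x => x ^ 3)]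
  norm_num

theorem integral_min {m : ℝ} (hm : m ∈ Set.Icc (-1) 1) :
    ∫ z in (-1 : ℝ)..1, min m z = 2 * m - (m + 1) ^ 2 / 2 := by
  have h (z : ℝ) : min m z = m - max (m + -z) 0 := by grind
  simp_rw [h]
  rw [intervalIntegral.integral_sub (Continuous.intervalIntegrable (by fun_prop) _ _)
    (Continuous.intervalIntegrable (by fun_prop) _ _),
    integral_comp_neg (fun z => max (m + z) 0), integral_max_zero]
  rw [max_eq_left (by linarith [hm.1]), max_eq_right (by linarith [hm.2])]
  norm_num

theorem integral_min_min :
    ∫ x in (-1 : ℝ)..1, ∫ y in (-1 : ℝ)..1, ∫ z in (-1 : ℝ)..1, min x (min y z) = -4 := by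
  have hy : ∀ x ∈ Set.uIcc (-1 : ℝ) 1,
      (∫ y in (-1 : ℝ)..1, ∫ z in (-1 : ℝ)..1, min x (min y z)) =
        4 * x - 2 * (x + 1) ^ 2 + (x + 1) ^ 3 / 3 := by
    intro x hx
    have hz : ∀ y ∈ Set.uIcc (-1 : ℝ) 1, (∫ z in (-1 : ℝ)..1, min x (min y z)) =
        (2 * x - (x + 1) ^ 2 / 2) + (x - 1) * max (x + -y) 0 - max (x + -y) 0 ^ 2 / 2 := by
      intro y hy
      rw [Set.uIcc_of_le (by norm_num)] at hx hy
      simp_rw [← min_assoc]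
      rw [integral_min ⟨le_min hx.1 hy.1, min_le_of_left_le hx.2⟩,
        show min x y = x - max (x + -y) 0 by grind]
      ring
    rw [intervalIntegral.integral_congr hz, integral_comp_neg (fun y => (2 * x - (x + 1) ^ 2 / 2) +
      (x - 1) * max (x + y) 0 - max (x + y) 0 ^ 2 / 2),
      intervalIntegral.integral_sub (Continuous.intervalIntegrable (by fun_prop) _ _)
        (Continuous.intervalIntegrable (by fun_prop) _ _),
      intervalIntegral.integral_add (Continuous.intervalIntegrable (by fun_prop) _ _)
        (Continuous.intervalIntegrable (by fun_prop) _ _),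
      intervalIntegral.integral_const_mul, intervalIntegral.integral_div, integral_max_zero,
      integral_max_zero_pow 1]
    rw [Set.uIcc_of_le (by norm_num)] at hx
    rw [neg_neg, max_eq_left (by linarith [hx.1]), max_eq_right (by linarith [hx.2])]
    norm_num
    ring
  have hF : ∀ x : ℝ, HasDerivAt (fun x : ℝ => 2 * x ^ 2 - 2 * (x + 1) ^ 3 / 3 + (x + 1) ^ 4 / 12)
      (4 * x - 2 * (x + 1) ^ 2 + (x + 1) ^ 3 / 3) x := by
    intro x
    have h := (hasDerivAt_id x).add_const 1
    refine ((((hasDerivAt_pow 2 x).const_mul 2).fun_sub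
      (((h.fun_pow 3).const_mul 2).div_const 3)).fun_add
        ((h.fun_pow 4).div_const 12)).congr_deriv ?_
    simp
    ring
  rw [intervalIntegral.integral_congr hy, integral_eq_sub_of_hasDerivAt (fun x _ => hF x)
    (Continuous.intervalIntegrable (by fun_prop) _ _)]
  norm_num

/-- `f` is integrable on the cube `[-1, 1]³`, with integral `A`. -/
def HasCubeIntegral (f : ℝ × ℝ × ℝ → ℝ) (A : ℝ) : Prop :=
  IntegrableOn f (Set.Icc (-1) 1 ×ˢ Set.Icc (-1) 1 ×ˢ Set.Icc (-1) 1) ∧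
    ∫ q in Set.Icc (-1) 1 ×ˢ Set.Icc (-1) 1 ×ˢ Set.Icc (-1) 1, f q = A

namespace HasCubeIntegral

variable {f g : ℝ × ℝ × ℝ → ℝ} {A B : ℝ}

theorem add (hf : HasCubeIntegral f A) (hg : HasCubeIntegral g B) :
    HasCubeIntegral (fun q => f q + g q) (A + B) :=
  ⟨hf.1.add hg.1, by rw [integral_add hf.1 hg.1, hf.2, hg.2]⟩

theorem sub (hf : HasCubeIntegral f A) (hg : HasCubeIntegral g B) :
    HasCubeIntegral (fun q => f q - g q) (A - B) :=
  ⟨hf.1.sub hg.1, by rw [integral_sub hf.1 hg.1, hf.2, hg.2]⟩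

theorem const_mul (k : ℝ) (hf : HasCubeIntegral f A) :
    HasCubeIntegral (fun q => k * f q) (k * A) :=
  ⟨hf.1.const_mul k, by rw [MeasureTheory.integral_const_mul, hf.2]⟩

theorem of_iterated {f : ℝ → ℝ → ℝ → ℝ} (hf : Continuous fun q : ℝ × ℝ × ℝ => f q.1 q.2.1 q.2.2)
    (h : ∫ x in (-1 : ℝ)..1, ∫ y in (-1 : ℝ)..1, ∫ z in (-1 : ℝ)..1, f x y z = A) :
    HasCubeIntegral (fun q => f q.1 q.2.1 q.2.2) A := by
  have hint : IntegrableOn (fun q : ℝ × ℝ × ℝ => f q.1 q.2.1 q.2.2)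
      (Set.Icc (-1) 1 ×ˢ Set.Icc (-1) 1 ×ˢ Set.Icc (-1) 1) :=
    hf.continuousOn.integrableOn_compact (isCompact_Icc.prod (isCompact_Icc.prod isCompact_Icc))
  refine ⟨hint, ?_⟩
  have hle : (-1 : ℝ) ≤ 1 := by norm_num
  rw [Measure.volume_eq_prod, setIntegral_prod _ hint, integral_Icc_eq_integral_Ioc, ← h,
    integral_of_le hle]
  congr 1 with x
  have hint' : IntegrableOn (fun q : ℝ × ℝ => f x q.1 q.2) (Set.Icc (-1) 1 ×ˢ Set.Icc (-1) 1) :=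
    (hf.comp (Continuous.prodMk_right x)).continuousOn.integrableOn_compact
      (isCompact_Icc.prod isCompact_Icc)
  rw [Measure.volume_eq_prod, setIntegral_prod _ hint', integral_Icc_eq_integral_Ioc,
    integral_of_le hle]
  congr 1 with y
  rw [integral_Icc_eq_integral_Ioc, integral_of_le hle]

theorem affine (k k₁ k₂ k₃ : ℝ) :
    HasCubeIntegral (fun q => k + k₁ * q.1 + k₂ * q.2.1 + k₃ * q.2.2) (8 * k) := by
  refine of_iterated (f := fun x y z => k + k₁ * x + k₂ * y + k₃ * z) (by fun_prop) ?_
  have h (r s : ℝ) : ∫ t in (-1 : ℝ)..1, (r + s * t) = 2 * r := by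
    rw [intervalIntegral.integral_add (by simp) (Continuous.intervalIntegrable (by fun_prop) _ _),
      intervalIntegral.integral_const_mul]
    norm_num
  have h' (r s : ℝ) : ∫ t in (-1 : ℝ)..1, 2 * (r + s * t) = 4 * r := by
    rw [intervalIntegral.integral_const_mul, h]; ring
  have h'' (r s : ℝ) : ∫ t in (-1 : ℝ)..1, 4 * (r + s * t) = 8 * r := by
    rw [intervalIntegral.integral_const_mul, h]; ring
  simp_rw [h, h', h'']

theorem corner {σ τ υ : ℝ} (hσ : σ ∈ ({-1, 1} : Set ℝ)) (hτ : τ ∈ ({-1, 1} : Set ℝ))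
    (hυ : υ ∈ ({-1, 1} : Set ℝ)) :
    HasCubeIntegral (fun q => max ((σ * q.1 + τ * q.2.1 + υ * q.2.2 - 1) / 2) 0) (1 / 3) :=
  of_iterated (f := fun x y z => max ((σ * x + τ * y + υ * z - 1) / 2) 0) (by fun_prop)
    (integral_corner hσ hτ hυ)

theorem min_min : HasCubeIntegral (fun q => min q.1 (min q.2.1 q.2.2)) (-4) :=
  of_iterated (f := fun x y z => min x (min y z)) (by fun_prop) integral_min_min

theorem upperEnv_sub_lowerEnv (a b c : ℝ) :
    HasCubeIntegral
      (fun q => upperEnv a b c q.1 q.2.1 q.2.2 - lowerEnv a b c q.1 q.2.1 q.2.2)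
      (4 / 3 * (a + b + c + 7)) := by
  have hp : (1 : ℝ) ∈ ({-1, 1} : Set ℝ) := by simp
  have hm : (-1 : ℝ) ∈ ({-1, 1} : Set ℝ) := by simp
  convert ((((((((affine (1 + (a + b + c)) (1 + a - b - c) (1 - a + b - c) (1 - a - b + c)).sub
    ((corner hm hp hp).const_mul (4 * (1 - a)))).sub
    ((corner hp hm hp).const_mul (4 * (1 - b)))).sub
    ((corner hp hp hm).const_mul (4 * (1 - c)))).add
    (min_min.const_mul (2 * (a + b + c - 1)))).sub
    ((corner hp hp hp).const_mul (2 * (1 + a + b + c)))).sub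
    ((corner hp hm hm).const_mul (2 * (1 + a - b - c)))).sub
    ((corner hm hp hm).const_mul (2 * (1 - a + b - c)))).sub
    ((corner hm hm hp).const_mul (2 * (1 - a - b + c))) using 1
  · ext q
    simp only [upperEnv, lowerEnv, one_mul, neg_one_mul, ← sub_eq_add_neg]
    ring
  · ring

end HasCubeIntegral

theorem measurePreserving_finFour : MeasurePreserving
    (fun p : Fin 4 → ℝ => ((p 0, p 1, p 2, p 3) : ℝ × ℝ × ℝ × ℝ)) :=
  ((MeasurePreserving.id volume).prod (((MeasurePreserving.id volume).prod
    (volume_preserving_piFinTwo fun _ => ℝ)).comp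
      (volume_preserving_piFinSuccAbove (fun _ : Fin 3 => ℝ) 0))).comp
    (volume_preserving_piFinSuccAbove (fun _ : Fin 4 => ℝ) 0)

theorem volume_envRegion {a b c : ℝ}
    (h : ∀ x ∈ Set.Icc (-1 : ℝ) 1, ∀ y ∈ Set.Icc (-1 : ℝ) 1, ∀ z ∈ Set.Icc (-1 : ℝ) 1,
      lowerEnv a b c x y z ≤ upperEnv a b c x y z) :
    volume (envRegion a b c) = ENNReal.ofReal (4 / 3 * (a + b + c + 7)) := by
  set C : Set (ℝ × ℝ × ℝ) := Set.Icc (-1) 1 ×ˢ Set.Icc (-1) 1 ×ˢ Set.Icc (-1) 1 with hC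
  have hCm : MeasurableSet C := measurableSet_Icc.prod (measurableSet_Icc.prod measurableSet_Icc)
  let T : Set (ℝ × ℝ × ℝ × ℝ) := {q | q.2 ∈ C ∧
    lowerEnv a b c q.2.1 q.2.2.1 q.2.2.2 ≤ q.1 ∧ q.1 ≤ upperEnv a b c q.2.1 q.2.2.1 q.2.2.2}
  have hT : MeasurableSet T := by
    have hl : Measurable fun q : ℝ × ℝ × ℝ × ℝ => lowerEnv a b c q.2.1 q.2.2.1 q.2.2.2 := by
      unfold lowerEnv; fun_prop
    have hu : Measurable fun q : ℝ × ℝ × ℝ × ℝ => upperEnv a b c q.2.1 q.2.2.1 q.2.2.2 := by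
      unfold upperEnv; fun_prop
    exact (measurable_snd hCm).inter
      ((measurableSet_le hl measurable_fst).inter (measurableSet_le measurable_fst hu))
  have hfiber (q : ℝ × ℝ × ℝ) : volume ((fun t => (t, q)) ⁻¹' T) = C.indicator (fun q =>
      ENNReal.ofReal (upperEnv a b c q.1 q.2.1 q.2.2 - lowerEnv a b c q.1 q.2.1 q.2.2)) q := by
    by_cases hq : q ∈ C
    · rw [Set.indicator_of_mem hq, ← Real.volume_Icc]
      congr 1
      ext t
      simp [T, hq]
    · rw [Set.indicator_of_notMem hq]
      convert measure_empty (μ := volume)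
      ext t
      simp [T, hq]
  obtain ⟨hint, hval⟩ := HasCubeIntegral.upperEnv_sub_lowerEnv a b c
  calc volume (envRegion a b c)
      = volume ((fun p : Fin 4 → ℝ => ((p 0, p 1, p 2, p 3) : ℝ × ℝ × ℝ × ℝ)) ⁻¹' T) := rfl
    _ = volume T := measurePreserving_finFour.measure_preimage hT.nullMeasurableSet
    _ = ∫⁻ q, volume ((fun t => (t, q)) ⁻¹' T) := by
        rw [Measure.volume_eq_prod, Measure.prod_apply_symm hT]
    _ = ∫⁻ q in C, ENNReal.ofReal
          (upperEnv a b c q.1 q.2.1 q.2.2 - lowerEnv a b c q.1 q.2.1 q.2.2) := by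
        simp_rw [hfiber]
        rw [lintegral_indicator hCm]
    _ = ENNReal.ofReal (4 / 3 * (a + b + c + 7)) := by
        rw [← hval, ofReal_integral_eq_lintegral_ofReal hint]
        filter_upwards [ae_restrict_mem hCm] with q hq
        exact sub_nonneg.2 (h _ hq.1 _ hq.2.1 _ hq.2.2)

end Integrals

theorem PH_eq_image {c₁ c₂ c₃ ℓ₁ ℓ₂ ℓ₃ : ℝ} (hℓ₁ : 0 < ℓ₁) (hℓ₂ : 0 < ℓ₂) (hℓ₃ : 0 < ℓ₃) :
    PH c₁ c₂ c₃ ℓ₁ ℓ₂ ℓ₃ =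
      (fun p => p + ![0, c₁, c₂, c₃]) ''
        (Matrix.toLin' (Matrix.diagonal ![ℓ₁ * ℓ₂ * ℓ₃, ℓ₁, ℓ₂, ℓ₃]) ''
          convexHull ℝ {p | ∃ x ∈ Set.Icc (-1) 1, ∃ y ∈ Set.Icc (-1) 1, ∃ z ∈ Set.Icc (-1) 1,
            p = graphPoint (c₁ / ℓ₁) (c₂ / ℓ₂) (c₃ / ℓ₃) x y z}) := by
  let F : (Fin 4 → ℝ) →ᵃ[ℝ] (Fin 4 → ℝ) :=
    (Matrix.toLin' (Matrix.diagonal ![ℓ₁ * ℓ₂ * ℓ₃, ℓ₁, ℓ₂, ℓ₃])).toAffineMap +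
      AffineMap.const ℝ _ ![0, c₁, c₂, c₃]
  have hF (x y z : ℝ) : F (graphPoint (c₁ / ℓ₁) (c₂ / ℓ₂) (c₃ / ℓ₃) x y z) =
      ![(ℓ₁ * x + c₁) * (ℓ₂ * y + c₂) * (ℓ₃ * z + c₃), ℓ₁ * x + c₁, ℓ₂ * y + c₂, ℓ₃ * z + c₃] := by
    ext i
    fin_cases i <;> simp [F, graphPoint, Matrix.mulVec_diagonal]
    field_simp
  have hmem {c ℓ t : ℝ} (hℓ : 0 < ℓ) (ht : t ∈ Set.Icc (-1) 1) :
      ℓ * t + c ∈ Set.Icc (c - ℓ) (c + ℓ) :=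
    ⟨by nlinarith [ht.1], by nlinarith [ht.2]⟩
  have hmem' {c ℓ t : ℝ} (hℓ : 0 < ℓ) (ht : t ∈ Set.Icc (c - ℓ) (c + ℓ)) :
      (t - c) / ℓ ∈ Set.Icc (-1) 1 := by
    rw [Set.mem_Icc, le_div_iff₀ hℓ, div_le_iff₀ hℓ]
    exact ⟨by linarith [ht.1], by linarith [ht.2]⟩
  rw [Set.image_image]
  refine Eq.trans ?_ (F.image_convexHull _).symm
  unfold PH
  congr 1
  ext p
  constructor
  · rintro ⟨x, y, z, hx, hy, hz, rfl⟩
    refine ⟨_, ⟨_, hmem' hℓ₁ hx, _, hmem' hℓ₂ hy, _, hmem' hℓ₃ hz, rfl⟩, ?_⟩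
    rw [hF]
    simp [mul_div_cancel₀, hℓ₁.ne', hℓ₂.ne', hℓ₃.ne']
  · rintro ⟨_, ⟨x, hx, y, hy, z, hz, rfl⟩, rfl⟩
    exact ⟨_, _, _, hmem hℓ₁ hx, hmem hℓ₂ hy, hmem hℓ₃ hz, hF x y z⟩

theorem convexHull_graphPoint_eq {a b c : ℝ} (ha : a ≤ 1) (hb : b ≤ 1) (hc : c ≤ 1)
    (hs : 1 ≤ a + b + c) (h₁ : 0 ≤ 1 + a - b - c) (h₂ : 0 ≤ 1 - a + b - c)
    (h₃ : 0 ≤ 1 - a - b + c) :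
    convexHull ℝ {p | ∃ x ∈ Set.Icc (-1) 1, ∃ y ∈ Set.Icc (-1) 1, ∃ z ∈ Set.Icc (-1) 1,
      p = graphPoint a b c x y z} = envRegion a b c := by
  have hconv := convex_envRegion ha hb hc hs h₁ h₂ h₃
  apply Set.Subset.antisymm
  · refine convexHull_min ?_ hconv
    rintro _ ⟨x, hx, y, hy, z, hz, rfl⟩
    exact graphPoint_mem_of_convex hconv graphPoint_vertex_mem_envRegion hx hy hz
  · have hI : ({-1, 1} : Set ℝ) ⊆ Set.Icc (-1) 1 := by
      rintro _ (rfl | rfl) <;> norm_num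
    exact envRegion_subset (convex_convexHull ℝ _) fun x hx y hy z hz =>
      subset_convexHull ℝ _ ⟨x, hI hx, y, hI hy, z, hI hz, rfl⟩

theorem volume_PH_case5 (c₁ c₂ c₃ ℓ₁ ℓ₂ ℓ₃ : ℝ)
    (hc₁ : 0 ≤ c₁) (hc₂ : 0 ≤ c₂) (hc₃ : 0 ≤ c₃)
    (hℓ₁ : 0 < ℓ₁) (hℓ₂ : 0 < ℓ₂) (hℓ₃ : 0 < ℓ₃)
    (hΩ₁ : c₁ / ℓ₁ ≤ c₂ / ℓ₂) (hΩ₂ : c₂ / ℓ₂ ≤ c₃ / ℓ₃)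
    (h₁ : c₃ / ℓ₃ < 1) (h₂ : 1 ≤ c₁ / ℓ₁ + c₂ / ℓ₂ + c₃ / ℓ₃)
    (h₃ : c₂ / ℓ₂ + c₃ / ℓ₃ < 1 + c₁ / ℓ₁) :
    volume (PH c₁ c₂ c₃ ℓ₁ ℓ₂ ℓ₃) =
      ENNReal.ofReal (4 / 3 * ℓ₁ ^ 2 * ℓ₂ ^ 2 * ℓ₃ ^ 2 *
        (c₁ / ℓ₁ + c₂ / ℓ₂ + c₃ / ℓ₃ + 7)) := by
  have hhull := convexHull_graphPoint_eq (a := c₁ / ℓ₁) (b := c₂ / ℓ₂) (c := c₃ / ℓ₃)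
    (by linarith) (by linarith) h₁.le h₂ (by linarith) (by linarith) (by linarith)
  have hle : ∀ x ∈ Set.Icc (-1 : ℝ) 1, ∀ y ∈ Set.Icc (-1 : ℝ) 1, ∀ z ∈ Set.Icc (-1 : ℝ) 1,
      lowerEnv (c₁ / ℓ₁) (c₂ / ℓ₂) (c₃ / ℓ₃) x y z ≤
        upperEnv (c₁ / ℓ₁) (c₂ / ℓ₂) (c₃ / ℓ₃) x y z := by
    intro x hx y hy z hz
    have hmem := hhull.subset (subset_convexHull ℝ _ ⟨x, hx, y, hy, z, hz, rfl⟩)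
    exact hmem.2.1.trans hmem.2.2
  have hdet : LinearMap.det (Matrix.toLin' (Matrix.diagonal ![ℓ₁ * ℓ₂ * ℓ₃, ℓ₁, ℓ₂, ℓ₃])) =
      ℓ₁ ^ 2 * ℓ₂ ^ 2 * ℓ₃ ^ 2 := by
    simp [LinearMap.det_toLin', Fin.prod_univ_four]
    ring
  rw [PH_eq_image hℓ₁ hℓ₂ hℓ₃, hhull, Set.image_add_right, measure_preimage_add_right,
    Measure.addHaar_image_linearMap, hdet, volume_envRegion hle, abs_of_pos (by positivity),
    ← ENNReal.ofReal_mul (by positivity)]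
  ring_nf
end

section
/- Let c₁,c₂,c₃ be arbitrary reals and ℓ₁,ℓ₂,ℓ₃ > 0, and set c̃ᵢ = |cᵢ| for i = 1,2,3. Then Vol₄(P_H(c,ℓ)) = Vol₄(P_H(c̃,ℓ)). -/
open MeasureTheory

lemma mul_mem_Icc_of_sign {s c ℓ x : ℝ} (hs : s = 1 ∨ s = -1)
    (hx : x ∈ Set.Icc (c - ℓ) (c + ℓ)) : s * x ∈ Set.Icc (s * c - ℓ) (s * c + ℓ) := by
  obtain ⟨h₁, h₂⟩ := hx
  rcases hs with rfl | rfl <;> constructor <;> linarith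

/-- Flipping signs of the coordinates is linear on the graph of `x₁x₂x₃`, with
determinant `±1`, and maps the hull over one box into the hull over the reflected box. -/
lemma volume_PH_le_volume_PH_mul_sign {s₁ s₂ s₃ : ℝ} (hs₁ : s₁ = 1 ∨ s₁ = -1)
    (hs₂ : s₂ = 1 ∨ s₂ = -1) (hs₃ : s₃ = 1 ∨ s₃ = -1) (c₁ c₂ c₃ ℓ₁ ℓ₂ ℓ₃ : ℝ) :
    volume (PH c₁ c₂ c₃ ℓ₁ ℓ₂ ℓ₃) ≤ volume (PH (s₁ * c₁) (s₂ * c₂) (s₃ * c₃) ℓ₁ ℓ₂ ℓ₃) := by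
  set f : (Fin 4 → ℝ) →ₗ[ℝ] (Fin 4 → ℝ) :=
    Matrix.toLin' (Matrix.diagonal ![s₁ * s₂ * s₃, s₁, s₂, s₃]) with hf
  have hdet : |LinearMap.det f| = 1 := by
    rw [hf, LinearMap.det_toLin', Matrix.det_diagonal]
    rcases hs₁ with rfl | rfl <;> rcases hs₂ with rfl | rfl <;> rcases hs₃ with rfl | rfl <;>
      simp [Fin.prod_univ_four]
  calc volume (PH c₁ c₂ c₃ ℓ₁ ℓ₂ ℓ₃)
      = volume (f '' PH c₁ c₂ c₃ ℓ₁ ℓ₂ ℓ₃) := by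
        rw [Measure.addHaar_image_linearMap, hdet, ENNReal.ofReal_one, one_mul]
    _ ≤ volume (PH (s₁ * c₁) (s₂ * c₂) (s₃ * c₃) ℓ₁ ℓ₂ ℓ₃) := by
        refine measure_mono ?_
        rw [PH, LinearMap.image_convexHull]
        refine convexHull_mono ?_
        rintro _ ⟨_, ⟨x₁, x₂, x₃, h₁, h₂, h₃, rfl⟩, rfl⟩
        refine ⟨s₁ * x₁, s₂ * x₂, s₃ * x₃, mul_mem_Icc_of_sign hs₁ h₁,
          mul_mem_Icc_of_sign hs₂ h₂, mul_mem_Icc_of_sign hs₃ h₃, ?_⟩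
        ext i
        fin_cases i <;> simp [hf, Matrix.mulVec_diagonal]
        ring

lemma exists_sign_mul_eq_abs (c : ℝ) :
    ∃ s : ℝ, (s = 1 ∨ s = -1) ∧ s * c = |c| ∧ s * |c| = c := by
  rcases abs_choice c with h | h
  · exact ⟨1, Or.inl rfl, by simp [h]⟩
  · exact ⟨-1, Or.inr rfl, by simp [h]⟩

theorem volume_PH_abs (c₁ c₂ c₃ ℓ₁ ℓ₂ ℓ₃ : ℝ)
    (hℓ₁ : 0 < ℓ₁) (hℓ₂ : 0 < ℓ₂) (hℓ₃ : 0 < ℓ₃) :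
    volume (PH c₁ c₂ c₃ ℓ₁ ℓ₂ ℓ₃) = volume (PH |c₁| |c₂| |c₃| ℓ₁ ℓ₂ ℓ₃) := by
  obtain ⟨s₁, hs₁, e₁, e₁'⟩ := exists_sign_mul_eq_abs c₁
  obtain ⟨s₂, hs₂, e₂, e₂'⟩ := exists_sign_mul_eq_abs c₂
  obtain ⟨s₃, hs₃, e₃, e₃'⟩ := exists_sign_mul_eq_abs c₃
  apply le_antisymm
  · simpa only [e₁, e₂, e₃] using
      volume_PH_le_volume_PH_mul_sign hs₁ hs₂ hs₃ c₁ c₂ c₃ ℓ₁ ℓ₂ ℓ₃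
  · simpa only [e₁', e₂', e₃'] using
      volume_PH_le_volume_PH_mul_sign hs₁ hs₂ hs₃ |c₁| |c₂| |c₃| ℓ₁ ℓ₂ ℓ₃
end

section
/- Assume cᵢ ≥ 0 and ℓᵢ > 0 for i = 1,2,3. Then the 3-dimensional Lebesgue volume of Q′ equals (8/3)·ℓ₁²ℓ₂²·(c₃ − ℓ₃) if c₃/ℓ₃ ≥ 1, and equals (8/3)·ℓ₁²ℓ₂²·(ℓ₃ − c₃) if c₃/ℓ₃ < 1. -/
open MeasureTheory

/-- The cross-section `Q'` of the hull of the graph of `x₁x₂x₃` at `x₃ = c₃ - ℓ₃`,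
in the `(f, x₁, x₂)` coordinates of `ℝ³`. -/
noncomputable def Qset (c₁ c₂ c₃ ℓ₁ ℓ₂ ℓ₃ : ℝ) : Set (Fin 3 → ℝ) :=
  convexHull ℝ
    ({![(c₁ - ℓ₁) * (c₂ - ℓ₂) * (c₃ - ℓ₃), c₁ - ℓ₁, c₂ - ℓ₂],
      ![(c₁ + ℓ₁) * (c₂ - ℓ₂) * (c₃ - ℓ₃), c₁ + ℓ₁, c₂ - ℓ₂],
      ![(c₁ - ℓ₁) * (c₂ + ℓ₂) * (c₃ - ℓ₃), c₁ - ℓ₁, c₂ + ℓ₂],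
      ![(c₁ + ℓ₁) * (c₂ + ℓ₂) * (c₃ - ℓ₃), c₁ + ℓ₁, c₂ + ℓ₂]} : Set (Fin 3 → ℝ))

/-- The cross-section `R'` of the hull of the graph of `x₁x₂x₃` at `x₃ = c₃ + ℓ₃`,
in the `(f, x₁, x₂)` coordinates of `ℝ³`. -/
noncomputable def Rset (c₁ c₂ c₃ ℓ₁ ℓ₂ ℓ₃ : ℝ) : Set (Fin 3 → ℝ) :=
  convexHull ℝ
    ({![(c₁ - ℓ₁) * (c₂ - ℓ₂) * (c₃ + ℓ₃), c₁ - ℓ₁, c₂ - ℓ₂],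
      ![(c₁ + ℓ₁) * (c₂ - ℓ₂) * (c₃ + ℓ₃), c₁ + ℓ₁, c₂ - ℓ₂],
      ![(c₁ - ℓ₁) * (c₂ + ℓ₂) * (c₃ + ℓ₃), c₁ - ℓ₁, c₂ + ℓ₂],
      ![(c₁ + ℓ₁) * (c₂ + ℓ₂) * (c₃ + ℓ₃), c₁ + ℓ₁, c₂ + ℓ₂]} : Set (Fin 3 → ℝ))

/-- The corner simplex of side `t` in `ℝⁿ`. -/
def cornerSimplex (n : ℕ) (t : ℝ) : Set (Fin n → ℝ) :=
  {x | (∀ i, 0 ≤ x i) ∧ ∑ i, x i ≤ t}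

theorem isClosed_cornerSimplex (n : ℕ) (t : ℝ) : IsClosed (cornerSimplex n t) := by
  have h : cornerSimplex n t = (⋂ i, {x | 0 ≤ x i}) ∩ {x | ∑ i, x i ≤ t} := by
    ext x; simp [cornerSimplex]
  rw [h]
  exact (isClosed_iInter fun i => isClosed_le continuous_const (continuous_apply i)).inter
    (isClosed_le (by fun_prop) continuous_const)

theorem cornerSimplex_eq_empty {n : ℕ} {t : ℝ} (ht : t < 0) : cornerSimplex n t = ∅ :=
  Set.eq_empty_of_forall_notMem fun _ hx =>
    absurd (Finset.sum_nonneg fun i _ => hx.1 i) (by linarith [hx.2])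

theorem volume_cornerSimplex (n : ℕ) {t : ℝ} (ht : 0 ≤ t) :
    volume (cornerSimplex n t) = ENNReal.ofReal (t ^ n / n.factorial) := by
  induction n generalizing t with
  | zero =>
    have h : cornerSimplex 0 t = Set.univ := by
      ext x; simp [cornerSimplex, ht]
    simp [h, volume_pi]
  | succ n ih =>
    have hpre : cornerSimplex (n + 1) t = MeasurableEquiv.piFinSuccAbove (fun _ => ℝ) 0 ⁻¹'
        {p : ℝ × (Fin n → ℝ) | 0 ≤ p.1 ∧ p.2 ∈ cornerSimplex n (t - p.1)} := by
      ext x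
      simp only [cornerSimplex, Set.mem_ofPred_eq, Fin.forall_fin_succ, Fin.sum_univ_succ,
        Set.mem_preimage, MeasurableEquiv.piFinSuccAbove_apply, Fin.insertNthEquiv_zero,
        Fin.consEquiv_symm_apply, Fin.tail, le_sub_iff_add_le', and_assoc]
    have hmeas : MeasurableSet
        {p : ℝ × (Fin n → ℝ) | 0 ≤ p.1 ∧ p.2 ∈ cornerSimplex n (t - p.1)} := by
      have := (isClosed_cornerSimplex (n + 1) t).measurableSet
      rwa [hpre, MeasurableEquiv.measurableSet_preimage] at this
    have hslice (s : ℝ) : volume (Prod.mk s ⁻¹'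
          {p : ℝ × (Fin n → ℝ) | 0 ≤ p.1 ∧ p.2 ∈ cornerSimplex n (t - p.1)}) =
        (Set.Icc 0 t).indicator (fun s => ENNReal.ofReal ((t - s) ^ n / n.factorial)) s := by
      by_cases hs : s ∈ Set.Icc 0 t
      · rw [Set.indicator_of_mem hs, ← ih (sub_nonneg.2 hs.2)]
        congr 1
        ext y; simp [hs.1]
      · rw [Set.indicator_of_notMem hs]
        refine measure_mono_null (t := ∅) (fun y hy => ?_) measure_empty
        rcases hy with ⟨h0, hy⟩
        have hts : t - s < 0 := by
          by_contra! h
          exact hs ⟨h0, by linarith⟩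
        simp only [cornerSimplex_eq_empty hts] at hy
        exact hy
    rw [hpre, (volume_preserving_piFinSuccAbove (fun _ => ℝ) 0).measure_preimage_equiv,
      Measure.volume_eq_prod, Measure.prod_apply hmeas]
    simp only [hslice]
    rw [lintegral_indicator measurableSet_Icc, ← ofReal_integral_eq_lintegral_ofReal]
    · rw [integral_Icc_eq_integral_Ioc, ← intervalIntegral.integral_of_le ht,
        intervalIntegral.integral_div,
        intervalIntegral.integral_comp_sub_left (fun u => u ^ n) t, integral_pow]
      congr 1
      rw [Nat.factorial_succ]
      push_cast
      simp [div_div]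
    · exact Continuous.integrableOn_Icc (by fun_prop)
    · filter_upwards [ae_restrict_mem measurableSet_Icc] with s hs
      have := sub_nonneg.2 hs.2
      positivity

theorem convexHull_insert_zero_range_single (n : ℕ) :
    convexHull ℝ (insert 0 (Set.range fun i : Fin n => Pi.single i (1 : ℝ))) =
      cornerSimplex n 1 := by
  apply Set.Subset.antisymm
  · refine convexHull_min ?_ ?_
    · rintro _ (rfl | ⟨i, rfl⟩)
      · simp [cornerSimplex]
      · exact ⟨fun j => by by_cases h : j = i <;> simp [h],
          by simp [Finset.sum_pi_single']⟩
    · rintro x hx y hy a b ha hb hab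
      refine ⟨fun i => add_nonneg (mul_nonneg ha (hx.1 i)) (mul_nonneg hb (hy.1 i)), ?_⟩
      simp only [Pi.add_apply, Pi.smul_apply, smul_eq_mul, Finset.sum_add_distrib,
        ← Finset.mul_sum]
      nlinarith [hx.2, hy.2]
  · rintro x ⟨hx, hsum⟩
    have key := (convex_convexHull ℝ
      (insert 0 (Set.range fun i : Fin n => Pi.single i (1 : ℝ)))).sum_mem
      (t := Finset.univ) (w := Fin.cons (1 - ∑ i, x i) x)
      (z := Fin.cons 0 fun i => Pi.single i (1 : ℝ))
      (fun i _ => by refine Fin.cases ?_ ?_ i <;> simp [hx, hsum])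
      (by simp [Fin.sum_univ_succ])
      (fun i _ => subset_convexHull ℝ _ (by refine Fin.cases ?_ ?_ i <;> simp))
    simpa [Fin.sum_univ_succ, ← pi_eq_sum_univ'] using key

/-- The volume of the simplex spanned by `n + 1` points of `ℝⁿ`. -/
theorem volume_convexHull_range {n : ℕ} (p : Fin (n + 1) → Fin n → ℝ) :
    volume (convexHull ℝ (Set.range p)) =
      ENNReal.ofReal (|(Matrix.of fun i j => p j.succ i - p 0 i).det| / n.factorial) := by
  set A : Matrix (Fin n) (Fin n) ℝ := Matrix.of fun i j => p j.succ i - p 0 i with hA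
  have hrange : Set.range p = (fun x => p 0 + x) '' (Matrix.toLin' A ''
      insert 0 (Set.range fun i : Fin n => Pi.single i (1 : ℝ))) := by
    have hcons : p = Fin.cons (p 0) fun i => p i.succ := (Fin.cons_self_tail p).symm
    rw [Set.image_insert_eq, Set.image_insert_eq, ← Set.range_comp, ← Set.range_comp, hcons,
      Fin.range_cons]
    congr 1
    · simp
    · congr 1
      ext i j
      simp [hA]
  have hhull : convexHull ℝ (Set.range p) =
      (fun x => p 0 + x) '' (Matrix.toLin' A '' cornerSimplex n 1) := by
    rw [hrange, ← convexHull_insert_zero_range_single, LinearMap.image_convexHull]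
    exact convexHull_vadd (p 0) _
  rw [hhull, Set.image_add_left, measure_preimage_add, Measure.addHaar_image_linearMap,
    LinearMap.det_toLin', volume_cornerSimplex n zero_le_one,
    ← ENNReal.ofReal_mul (abs_nonneg _)]
  simp [div_eq_mul_inv]

theorem volume_Qset_eq_abs (c₁ c₂ c₃ ℓ₁ ℓ₂ ℓ₃ : ℝ) :
    volume (Qset c₁ c₂ c₃ ℓ₁ ℓ₂ ℓ₃) =
      ENNReal.ofReal (8 / 3 * ℓ₁ ^ 2 * ℓ₂ ^ 2 * |c₃ - ℓ₃|) := by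
  have hrange : Qset c₁ c₂ c₃ ℓ₁ ℓ₂ ℓ₃ = convexHull ℝ (Set.range
     ![![(c₁ - ℓ₁) * (c₂ - ℓ₂) * (c₃ - ℓ₃), c₁ - ℓ₁, c₂ - ℓ₂],
      ![(c₁ + ℓ₁) * (c₂ - ℓ₂) * (c₃ - ℓ₃), c₁ + ℓ₁, c₂ - ℓ₂],
      ![(c₁ - ℓ₁) * (c₂ + ℓ₂) * (c₃ - ℓ₃), c₁ - ℓ₁, c₂ + ℓ₂],
      ![(c₁ + ℓ₁) * (c₂ + ℓ₂) * (c₃ - ℓ₃), c₁ + ℓ₁, c₂ + ℓ₂]]) := by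
    simp only [Qset, Matrix.range_cons, Matrix.range_empty, Set.union_empty, Set.singleton_union]
  rw [hrange, volume_convexHull_range, Matrix.det_fin_three]
  have habs : 16 * ℓ₁ ^ 2 * ℓ₂ ^ 2 * |c₃ - ℓ₃| = |16 * ℓ₁ ^ 2 * ℓ₂ ^ 2 * (c₃ - ℓ₃)| := by
    rw [abs_mul, abs_of_nonneg (by positivity : 0 ≤ 16 * ℓ₁ ^ 2 * ℓ₂ ^ 2)]
  have h : 8 / 3 * ℓ₁ ^ 2 * ℓ₂ ^ 2 * |c₃ - ℓ₃| =
      |16 * ℓ₁ ^ 2 * ℓ₂ ^ 2 * (c₃ - ℓ₃)| / Nat.factorial 3 := by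
    rw [← habs]
    norm_num [Nat.factorial]
    ring
  rw [h]
  congr 3
  simp [Fin.succ]
  ring

theorem volume_Qset (c₁ c₂ c₃ ℓ₁ ℓ₂ ℓ₃ : ℝ)
    (hc₁ : 0 ≤ c₁) (hc₂ : 0 ≤ c₂) (hc₃ : 0 ≤ c₃)
    (hℓ₁ : 0 < ℓ₁) (hℓ₂ : 0 < ℓ₂) (hℓ₃ : 0 < ℓ₃) :
    (1 ≤ c₃ / ℓ₃ →
      volume (Qset c₁ c₂ c₃ ℓ₁ ℓ₂ ℓ₃) =
        ENNReal.ofReal (8 / 3 * ℓ₁ ^ 2 * ℓ₂ ^ 2 * (c₃ - ℓ₃))) ∧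
    (c₃ / ℓ₃ < 1 →
      volume (Qset c₁ c₂ c₃ ℓ₁ ℓ₂ ℓ₃) =
        ENNReal.ofReal (8 / 3 * ℓ₁ ^ 2 * ℓ₂ ^ 2 * (ℓ₃ - c₃))) := by
  refine ⟨fun h => ?_, fun h => ?_⟩
  · rw [volume_Qset_eq_abs, abs_of_nonneg (sub_nonneg.2 ((one_le_div hℓ₃).1 h))]
  · rw [volume_Qset_eq_abs, abs_sub_comm,
      abs_of_nonneg (sub_nonneg.2 ((div_lt_one hℓ₃).1 h).le)]
end

section
/- Assume cᵢ ≥ 0 and ℓᵢ > 0 for i = 1,2,3 and the ordering condition (Ω′). Let ε = +1 if c₃/ℓ₃ ≥ 1 and ε = −1 if c₃/ℓ₃ < 1, and define M = (2ℓ₁ℓ₂/3)·Σᵢ₌₁⁴ sup{⟨x, ε·uᵢ⟩ : x ∈ R′} (this quantity equals the mixed volume V(Q′,Q′,R′)). Then: M = (8/3)ℓ₁ℓ₂(c₃ℓ₁ℓ₂ + ℓ₃(2c₂ℓ₁ + c₁ℓ₂)) if c₁/ℓ₁ ≥ 1; M = (8/3)ℓ₁²ℓ₂(2c₂ℓ₃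 + ℓ₂(c₃+ℓ₃)) if c₁/ℓ₁ < 1, c₁/ℓ₁ + c₂/ℓ₂ + c₃/ℓ₃ ≥ 1, and c₂/ℓ₂ + c₃/ℓ₃ ≥ 1 + c₁/ℓ₁; M = (8/3)ℓ₁ℓ₂ℓ₃(c₂ℓ₁ + ℓ₂(c₁ + 2ℓ₁)) if c₁/ℓ₁ < 1, c₁/ℓ₁ + c₂/ℓ₂ + c₃/ℓ₃ ≥ 1, and c₂/ℓ₂ + c₃/ℓ₃ < 1 + c₁/ℓ₁; and M = (8/3)ℓ₁²ℓ₂²(3ℓ₃ − c₃) if c₁/ℓ₁ + c₂/ℓ₂ + c₃/ℓ₃ < 1. -/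
open MeasureTheory

/-- The standard inner product on `ℝ³ = Fin 3 → ℝ`. -/
noncomputable def dot3 (u v : Fin 3 → ℝ) : ℝ := ∑ i, u i * v i

/-- The support function of the polytope `R'` in direction `u` is the value at a vertex of `R'`
that dominates all vertices. -/
lemma sSup_dot3_Rset_eq {c₁ c₂ c₃ ℓ₁ ℓ₂ ℓ₃ d : ℝ} {u : Fin 3 → ℝ} {s t : ℝ}
    (hs : s = -1 ∨ s = 1) (ht : t = -1 ∨ t = 1)
    (hd : d = dot3 ![(c₁ + s * ℓ₁) * (c₂ + t * ℓ₂) * (c₃ + ℓ₃), c₁ + s * ℓ₁, c₂ + t * ℓ₂] u)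
    (h₁ : dot3 ![(c₁ - ℓ₁) * (c₂ - ℓ₂) * (c₃ + ℓ₃), c₁ - ℓ₁, c₂ - ℓ₂] u ≤ d)
    (h₂ : dot3 ![(c₁ + ℓ₁) * (c₂ - ℓ₂) * (c₃ + ℓ₃), c₁ + ℓ₁, c₂ - ℓ₂] u ≤ d)
    (h₃ : dot3 ![(c₁ - ℓ₁) * (c₂ + ℓ₂) * (c₃ + ℓ₃), c₁ - ℓ₁, c₂ + ℓ₂] u ≤ d)
    (h₄ : dot3 ![(c₁ + ℓ₁) * (c₂ + ℓ₂) * (c₃ + ℓ₃), c₁ + ℓ₁, c₂ + ℓ₂] u ≤ d) :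
    sSup {z : ℝ | ∃ x ∈ Rset c₁ c₂ c₃ ℓ₁ ℓ₂ ℓ₃, z = dot3 x u} = d := by
  refine IsGreatest.csSup_eq ⟨⟨_, subset_convexHull ℝ _ ?_, hd⟩, ?_⟩
  · rcases hs with rfl | rfl <;> rcases ht with rfl | rfl <;> simp [← sub_eq_add_neg]
  · rintro z ⟨x, hx, rfl⟩
    have hlin : IsLinearMap ℝ fun x : Fin 3 → ℝ => dot3 x u :=
      ⟨fun x y => by simp [dot3, add_mul, Finset.sum_add_distrib],
        fun a x => by simp [dot3, mul_assoc, Finset.mul_sum]⟩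
    have hsub : Rset c₁ c₂ c₃ ℓ₁ ℓ₂ ℓ₃ ⊆ {x | dot3 x u ≤ d} := by
      refine convexHull_min ?_ (convex_halfSpace_le hlin d)
      rintro y (rfl | rfl | rfl | rfl) <;> assumption
    exact hsub hx

/-- The value of a linear functional at the vertex `(s, t)` of `R'`, in coordinates rescaled so that
the box has unit half-edges and centre `(a₁, a₂, a₃)`. -/
noncomputable def vertexValue (a₁ a₂ a₃ p q r s t : ℝ) : ℝ :=
  p * ((a₁ + s) * (a₂ + t) * (a₃ + 1)) + q * (a₁ + s) + r * (a₂ + t)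

/-- A rescaled version of `sSup_dot3_Rset_eq`. -/
lemma sSup_dot3_Rset_eq_vertexValue {a₁ a₂ a₃ ℓ₁ ℓ₂ ℓ₃ : ℝ} (p q r s t : ℝ)
    (hℓ₁ : 0 < ℓ₁) (hℓ₂ : 0 < ℓ₂) (hℓ₃ : 0 < ℓ₃) {u : Fin 3 → ℝ}
    (hu : u = ![p, q * (ℓ₂ * ℓ₃), r * (ℓ₁ * ℓ₃)])
    (hs : s = -1 ∨ s = 1) (ht : t = -1 ∨ t = 1)
    (h : ∀ s' ∈ ({-1, 1} : Set ℝ), ∀ t' ∈ ({-1, 1} : Set ℝ),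
      vertexValue a₁ a₂ a₃ p q r s' t' ≤ vertexValue a₁ a₂ a₃ p q r s t) :
    sSup {z : ℝ | ∃ x ∈ Rset (a₁ * ℓ₁) (a₂ * ℓ₂) (a₃ * ℓ₃) ℓ₁ ℓ₂ ℓ₃, z = dot3 x u} =
      ℓ₁ * ℓ₂ * ℓ₃ * vertexValue a₁ a₂ a₃ p q r s t := by
  have hK : 0 ≤ ℓ₁ * ℓ₂ * ℓ₃ := by positivity
  have key : ∀ s' ∈ ({-1, 1} : Set ℝ), ∀ t' ∈ ({-1, 1} : Set ℝ), _ :=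
    fun s' hs' t' ht' => mul_le_mul_of_nonneg_left (h s' hs' t' ht') hK
  subst hu
  refine sSup_dot3_Rset_eq hs ht ?_
    (le_trans (le_of_eq ?_) (key (-1) (by simp) (-1) (by simp)))
    (le_trans (le_of_eq ?_) (key 1 (by simp) (-1) (by simp)))
    (le_trans (le_of_eq ?_) (key (-1) (by simp) 1 (by simp)))
    (le_trans (le_of_eq ?_) (key 1 (by simp) 1 (by simp)))
  all_goals
    simp only [dot3, vertexValue, Fin.sum_univ_three, Matrix.cons_val]
    ring

theorem mixed_volume_QQR (c₁ c₂ c₃ ℓ₁ ℓ₂ ℓ₃ : ℝ)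
    (hc₁ : 0 ≤ c₁) (hc₂ : 0 ≤ c₂) (hc₃ : 0 ≤ c₃)
    (hℓ₁ : 0 < ℓ₁) (hℓ₂ : 0 < ℓ₂) (hℓ₃ : 0 < ℓ₃)
    (hΩ₁ : c₁ / ℓ₁ ≤ c₂ / ℓ₂) (hΩ₂ : c₂ / ℓ₂ ≤ c₃ / ℓ₃)
    (ε : ℝ) (hε : ε = if 1 ≤ c₃ / ℓ₃ then 1 else -1)
    (u₁ u₂ u₃ u₄ : Fin 3 → ℝ)
    (hu₁ : u₁ = ![1, -((c₂ - ℓ₂) * (c₃ - ℓ₃)), -((c₁ + ℓ₁) * (c₃ - ℓ₃))])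
    (hu₂ : u₂ = ![1, -((c₂ + ℓ₂) * (c₃ - ℓ₃)), -((c₁ - ℓ₁) * (c₃ - ℓ₃))])
    (hu₃ : u₃ = ![-1, (c₂ + ℓ₂) * (c₃ - ℓ₃), (c₁ + ℓ₁) * (c₃ - ℓ₃)])
    (hu₄ : u₄ = ![-1, (c₂ - ℓ₂) * (c₃ - ℓ₃), (c₁ - ℓ₁) * (c₃ - ℓ₃)])
    (M : ℝ)
    (hM : M = 2 * ℓ₁ * ℓ₂ / 3 *
      (sSup {z : ℝ | ∃ x ∈ Rset c₁ c₂ c₃ ℓ₁ ℓ₂ ℓ₃, z = dot3 x (ε • u₁)} +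
       sSup {z : ℝ | ∃ x ∈ Rset c₁ c₂ c₃ ℓ₁ ℓ₂ ℓ₃, z = dot3 x (ε • u₂)} +
       sSup {z : ℝ | ∃ x ∈ Rset c₁ c₂ c₃ ℓ₁ ℓ₂ ℓ₃, z = dot3 x (ε • u₃)} +
       sSup {z : ℝ | ∃ x ∈ Rset c₁ c₂ c₃ ℓ₁ ℓ₂ ℓ₃, z = dot3 x (ε • u₄)})) :
    (1 ≤ c₁ / ℓ₁ →
      M = 8 / 3 * ℓ₁ * ℓ₂ * (c₃ * ℓ₁ * ℓ₂ + ℓ₃ * (2 * c₂ * ℓ₁ + c₁ * ℓ₂))) ∧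
    (c₁ / ℓ₁ < 1 → 1 ≤ c₁ / ℓ₁ + c₂ / ℓ₂ + c₃ / ℓ₃ →
      1 + c₁ / ℓ₁ ≤ c₂ / ℓ₂ + c₃ / ℓ₃ →
      M = 8 / 3 * ℓ₁ ^ 2 * ℓ₂ * (2 * c₂ * ℓ₃ + ℓ₂ * (c₃ + ℓ₃))) ∧
    (c₁ / ℓ₁ < 1 → 1 ≤ c₁ / ℓ₁ + c₂ / ℓ₂ + c₃ / ℓ₃ →
      c₂ / ℓ₂ + c₃ / ℓ₃ < 1 + c₁ / ℓ₁ →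
      M = 8 / 3 * ℓ₁ * ℓ₂ * ℓ₃ * (c₂ * ℓ₁ + ℓ₂ * (c₁ + 2 * ℓ₁))) ∧
    (c₁ / ℓ₁ + c₂ / ℓ₂ + c₃ / ℓ₃ < 1 →
      M = 8 / 3 * ℓ₁ ^ 2 * ℓ₂ ^ 2 * (3 * ℓ₃ - c₃)) := by
  obtain ⟨a₁, rfl⟩ : ∃ a, c₁ = a * ℓ₁ := ⟨c₁ / ℓ₁, by field_simp⟩
  obtain ⟨a₂, rfl⟩ : ∃ a, c₂ = a * ℓ₂ := ⟨c₂ / ℓ₂, by field_simp⟩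
  obtain ⟨a₃, rfl⟩ : ∃ a, c₃ = a * ℓ₃ := ⟨c₃ / ℓ₃, by field_simp⟩
  simp only [mul_div_cancel_right₀ _ hℓ₁.ne', mul_div_cancel_right₀ _ hℓ₂.ne',
    mul_div_cancel_right₀ _ hℓ₃.ne'] at hΩ₁ hΩ₂ hε ⊢
  have ha₁ : 0 ≤ a₁ := nonneg_of_mul_nonneg_left hc₁ hℓ₁
  have S₁ := fun s t => sSup_dot3_Rset_eq_vertexValue (a₁ := a₁) (a₂ := a₂) (a₃ := a₃) (u := ε • u₁)
    ε (-(ε * ((a₂ - 1) * (a₃ - 1)))) (-(ε * ((a₁ + 1) * (a₃ - 1)))) s t hℓ₁ hℓ₂ hℓ₃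
    (by rw [hu₁]; ext i; fin_cases i <;> simp <;> ring)
  have S₂ := fun s t => sSup_dot3_Rset_eq_vertexValue (a₁ := a₁) (a₂ := a₂) (a₃ := a₃) (u := ε • u₂)
    ε (-(ε * ((a₂ + 1) * (a₃ - 1)))) (-(ε * ((a₁ - 1) * (a₃ - 1)))) s t hℓ₁ hℓ₂ hℓ₃
    (by rw [hu₂]; ext i; fin_cases i <;> simp <;> ring)
  have S₃ := fun s t => sSup_dot3_Rset_eq_vertexValue (a₁ := a₁) (a₂ := a₂) (a₃ := a₃) (u := ε • u₃)
    (-ε) (ε * ((a₂ + 1) * (a₃ - 1))) (ε * ((a₁ + 1) * (a₃ - 1))) s t hℓ₁ hℓ₂ hℓ₃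
    (by rw [hu₃]; ext i; fin_cases i <;> simp <;> ring)
  have S₄ := fun s t => sSup_dot3_Rset_eq_vertexValue (a₁ := a₁) (a₂ := a₂) (a₃ := a₃) (u := ε • u₄)
    (-ε) (ε * ((a₂ - 1) * (a₃ - 1))) (ε * ((a₁ - 1) * (a₃ - 1))) s t hℓ₁ hℓ₂ hℓ₃
    (by rw [hu₄]; ext i; fin_cases i <;> simp <;> ring)
  refine ⟨fun h₁ => ?_, fun h₁ h₂ h₃ => ?_, fun h₁ h₂ h₃ => ?_, fun h₁ => ?_⟩
  · rw [if_pos (by linarith)] at hε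
    have T₁ := S₁ 1 1 (by simp) (by simp) (by
      rintro s' (rfl | rfl) t' (rfl | rfl) <;> simp only [vertexValue, hε] <;> linarith)
    have T₂ := S₂ 1 1 (by simp) (by simp) (by
      rintro s' (rfl | rfl) t' (rfl | rfl) <;> simp only [vertexValue, hε] <;> linarith)
    have T₃ := S₃ (-1) 1 (by simp) (by simp) (by
      rintro s' (rfl | rfl) t' (rfl | rfl) <;> simp only [vertexValue, hε] <;> linarith)
    have T₄ := S₄ (-1) (-1) (by simp) (by simp) (by
      rintro s' (rfl | rfl) t' (rfl | rfl) <;> simp only [vertexValue, hε] <;> linarith)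
    rw [hM, T₁, T₂, T₃, T₄]
    simp only [vertexValue, hε]
    ring
  · split_ifs at hε with h
    · have T₁ := S₁ 1 1 (by simp) (by simp) (by
        rintro s' (rfl | rfl) t' (rfl | rfl) <;> simp only [vertexValue, hε] <;> linarith)
      have T₂ := S₂ 1 1 (by simp) (by simp) (by
        rintro s' (rfl | rfl) t' (rfl | rfl) <;> simp only [vertexValue, hε] <;> linarith)
      have T₃ := S₃ (-1) 1 (by simp) (by simp) (by
        rintro s' (rfl | rfl) t' (rfl | rfl) <;> simp only [vertexValue, hε] <;> linarith)
      have T₄ := S₄ (-1) 1 (by simp) (by simp) (by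
        rintro s' (rfl | rfl) t' (rfl | rfl) <;> simp only [vertexValue, hε] <;> linarith)
      rw [hM, T₁, T₂, T₃, T₄]
      simp only [vertexValue, hε]
      ring
    · rw [not_le] at h
      have T₁ := S₁ (-1) 1 (by simp) (by simp) (by
        rintro s' (rfl | rfl) t' (rfl | rfl) <;> simp only [vertexValue, hε] <;> linarith)
      have T₂ := S₂ (-1) 1 (by simp) (by simp) (by
        rintro s' (rfl | rfl) t' (rfl | rfl) <;> simp only [vertexValue, hε] <;> linarith)
      have T₃ := S₃ 1 1 (by simp) (by simp) (by
        rintro s' (rfl | rfl) t' (rfl | rfl) <;> simp only [vertexValue, hε] <;> linarith)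
      have T₄ := S₄ 1 1 (by simp) (by simp) (by
        rintro s' (rfl | rfl) t' (rfl | rfl) <;> simp only [vertexValue, hε] <;> linarith)
      rw [hM, T₁, T₂, T₃, T₄]
      simp only [vertexValue, hε]
      ring
  · rw [if_neg (by linarith)] at hε
    have T₁ := S₁ 1 (-1) (by simp) (by simp) (by
      rintro s' (rfl | rfl) t' (rfl | rfl) <;> simp only [vertexValue, hε] <;> linarith)
    have T₂ := S₂ (-1) 1 (by simp) (by simp) (by
      rintro s' (rfl | rfl) t' (rfl | rfl) <;> simp only [vertexValue, hε] <;> linarith)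
    have T₃ := S₃ 1 1 (by simp) (by simp) (by
      rintro s' (rfl | rfl) t' (rfl | rfl) <;> simp only [vertexValue, hε] <;> linarith)
    have T₄ := S₄ 1 1 (by simp) (by simp) (by
      rintro s' (rfl | rfl) t' (rfl | rfl) <;> simp only [vertexValue, hε] <;> linarith)
    rw [hM, T₁, T₂, T₃, T₄]
    simp only [vertexValue, hε]
    ring
  · rw [if_neg (by linarith)] at hε
    have T₁ := S₁ 1 (-1) (by simp) (by simp) (by
      rintro s' (rfl | rfl) t' (rfl | rfl) <;> simp only [vertexValue, hε] <;> linarith)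
    have T₂ := S₂ (-1) 1 (by simp) (by simp) (by
      rintro s' (rfl | rfl) t' (rfl | rfl) <;> simp only [vertexValue, hε] <;> linarith)
    have T₃ := S₃ 1 1 (by simp) (by simp) (by
      rintro s' (rfl | rfl) t' (rfl | rfl) <;> simp only [vertexValue, hε] <;> linarith)
    have T₄ := S₄ (-1) (-1) (by simp) (by simp) (by
      rintro s' (rfl | rfl) t' (rfl | rfl) <;> simp only [vertexValue, hε] <;> linarith)
    rw [hM, T₁, T₂, T₃, T₄]
    simp only [vertexValue, hε]
    ring
end

section
/- Assume cᵢ ≥ 0 and ℓᵢ > 0 for i = 1,2,3 and the ordering condition (Ω′). Let u₁ = (1, −(c₂−ℓ₂)(c₃−ℓ₃), −(c₁+ℓ₁)(c₃−ℓ₃)) ∈ ℝ³. Then (i) max{⟨v₅′,u₁⟩, ⟨v₆′,u₁⟩, ⟨v₇′,u₁⟩, ⟨v₈′,u₁⟩} = ⟨v₈′,u₁⟩ = (c₁+ℓ₁)(ℓ₂(c₃+ℓ₃) − c₂(c₃−3ℓ₃)); and (ii) if c₂/ℓ₂ + c₃/ℓ₃ ≥ 1 + c₁/ℓ₁ then max{−⟨v₅′,u₁⟩,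 −⟨v₆′,u₁⟩, −⟨v₇′,u₁⟩, −⟨v₈′,u₁⟩} = −⟨v₇′,u₁⟩, while if c₂/ℓ₂ + c₃/ℓ₃ < 1 + c₁/ℓ₁ then this maximum equals −⟨v₆′,u₁⟩ = (c₁+ℓ₁)(c₂−ℓ₂)(c₃−3ℓ₃). -/
theorem lemma_z1 (c₁ c₂ c₃ ℓ₁ ℓ₂ ℓ₃ : ℝ)
    (hc₁ : 0 ≤ c₁) (hc₂ : 0 ≤ c₂) (hc₃ : 0 ≤ c₃)
    (hℓ₁ : 0 < ℓ₁) (hℓ₂ : 0 < ℓ₂) (hℓ₃ : 0 < ℓ₃)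
    (hΩ₁ : c₁ / ℓ₁ ≤ c₂ / ℓ₂) (hΩ₂ : c₂ / ℓ₂ ≤ c₃ / ℓ₃)
    (v₅ v₆ v₇ v₈ : Fin 3 → ℝ)
    (hv₅ : v₅ = ![(c₁ - ℓ₁) * (c₂ - ℓ₂) * (c₃ + ℓ₃), c₁ - ℓ₁, c₂ - ℓ₂])
    (hv₆ : v₆ = ![(c₁ + ℓ₁) * (c₂ - ℓ₂) * (c₃ + ℓ₃), c₁ + ℓ₁, c₂ - ℓ₂])
    (hv₇ : v₇ = ![(c₁ - ℓ₁) * (c₂ + ℓ₂) * (c₃ + ℓ₃), c₁ - ℓ₁, c₂ + ℓ₂])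
    (hv₈ : v₈ = ![(c₁ + ℓ₁) * (c₂ + ℓ₂) * (c₃ + ℓ₃), c₁ + ℓ₁, c₂ + ℓ₂])
    (u₁ : Fin 3 → ℝ)
    (hu₁ : u₁ = ![1, -((c₂ - ℓ₂) * (c₃ - ℓ₃)), -((c₁ + ℓ₁) * (c₃ - ℓ₃))]) :
    (max (max (dot3 v₅ u₁) (dot3 v₆ u₁)) (max (dot3 v₇ u₁) (dot3 v₈ u₁)) = dot3 v₈ u₁ ∧
      dot3 v₈ u₁ = (c₁ + ℓ₁) * (ℓ₂ * (c₃ + ℓ₃) - c₂ * (c₃ - 3 * ℓ₃))) ∧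
    (1 + c₁ / ℓ₁ ≤ c₂ / ℓ₂ + c₃ / ℓ₃ →
      max (max (-dot3 v₅ u₁) (-dot3 v₆ u₁)) (max (-dot3 v₇ u₁) (-dot3 v₈ u₁)) =
        -dot3 v₇ u₁) ∧
    (c₂ / ℓ₂ + c₃ / ℓ₃ < 1 + c₁ / ℓ₁ →
      max (max (-dot3 v₅ u₁) (-dot3 v₆ u₁)) (max (-dot3 v₇ u₁) (-dot3 v₈ u₁)) =
        -dot3 v₆ u₁ ∧
      -dot3 v₆ u₁ = (c₁ + ℓ₁) * (c₂ - ℓ₂) * (c₃ - 3 * ℓ₃)) := by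
  obtain ⟨a, rfl⟩ : ∃ a, c₁ = a * ℓ₁ := ⟨c₁ / ℓ₁, by field_simp⟩
  obtain ⟨b, rfl⟩ : ∃ b, c₂ = b * ℓ₂ := ⟨c₂ / ℓ₂, by field_simp⟩
  obtain ⟨c, rfl⟩ : ∃ c, c₃ = c * ℓ₃ := ⟨c₃ / ℓ₃, by field_simp⟩
  have ha : 0 ≤ a := nonneg_of_mul_nonneg_left hc₁ hℓ₁
  have hb : 0 ≤ b := nonneg_of_mul_nonneg_left hc₂ hℓ₂
  have hc : 0 ≤ c := nonneg_of_mul_nonneg_left hc₃ hℓ₃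
  simp only [mul_div_cancel_right₀ _ hℓ₁.ne', mul_div_cancel_right₀ _ hℓ₂.ne',
    mul_div_cancel_right₀ _ hℓ₃.ne'] at hΩ₁ hΩ₂ ⊢
  have hV : 0 < ℓ₁ * ℓ₂ * ℓ₃ := by positivity
  have e₅ : dot3 v₈ u₁ - dot3 v₅ u₁ = 4 * (ℓ₁ * ℓ₂ * ℓ₃ * (a + b)) := by
    simp [dot3, Fin.sum_univ_three, hv₈, hv₅, hu₁]; ring
  have e₆ : dot3 v₈ u₁ - dot3 v₆ u₁ = 4 * (ℓ₁ * ℓ₂ * ℓ₃ * (a + 1)) := by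
    simp [dot3, Fin.sum_univ_three, hv₈, hv₆, hu₁]; ring
  have e₇ : dot3 v₈ u₁ - dot3 v₇ u₁ = 4 * (ℓ₁ * ℓ₂ * ℓ₃ * (b + c)) := by
    simp [dot3, Fin.sum_univ_three, hv₈, hv₇, hu₁]; ring
  have h₅ : 0 ≤ ℓ₁ * ℓ₂ * ℓ₃ * (a + b) := by positivity
  have h₆ : 0 ≤ ℓ₁ * ℓ₂ * ℓ₃ * (a + 1) := by positivity
  have h₇ : 0 ≤ ℓ₁ * ℓ₂ * ℓ₃ * (b + c) := by positivity
  refine ⟨⟨?_, ?_⟩, fun h => ?_, fun h => ⟨?_, ?_⟩⟩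
  · apply le_antisymm
    · refine max_le (max_le ?_ ?_) (max_le ?_ le_rfl) <;> linarith
    · simp
  · simp [dot3, Fin.sum_univ_three, hv₈, hu₁]; ring
  · have h₅₇ : ℓ₁ * ℓ₂ * ℓ₃ * (a + b) ≤ ℓ₁ * ℓ₂ * ℓ₃ * (b + c) :=
      mul_le_mul_of_nonneg_left (by linarith) hV.le
    have h₆₇ : ℓ₁ * ℓ₂ * ℓ₃ * (a + 1) ≤ ℓ₁ * ℓ₂ * ℓ₃ * (b + c) :=
      mul_le_mul_of_nonneg_left (by linarith) hV.le
    apply le_antisymm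
    · refine max_le (max_le ?_ ?_) (max_le le_rfl ?_) <;> linarith
    · exact (le_max_left _ _).trans (le_max_right _ _)
  · have h₅₆ : ℓ₁ * ℓ₂ * ℓ₃ * (a + b) ≤ ℓ₁ * ℓ₂ * ℓ₃ * (a + 1) :=
      mul_le_mul_of_nonneg_left (by linarith) hV.le
    have h₇₆ : ℓ₁ * ℓ₂ * ℓ₃ * (b + c) ≤ ℓ₁ * ℓ₂ * ℓ₃ * (a + 1) :=
      mul_le_mul_of_nonneg_left (by linarith) hV.le
    apply le_antisymm
    · refine max_le (max_le ?_ le_rfl) (max_le ?_ ?_) <;> linarith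
    · exact (le_max_right _ _).trans (le_max_left _ _)
  · simp [dot3, Fin.sum_univ_three, hv₆, hu₁]; ring
end

section
/- Assume cᵢ ≥ 0 and ℓᵢ > 0 for i = 1,2,3 and the ordering condition (Ω′). Let u₂ = (1, −(c₂+ℓ₂)(c₃−ℓ₃), −(c₁−ℓ₁)(c₃−ℓ₃)) ∈ ℝ³. Then (i) max{⟨v₅′,u₂⟩, ⟨v₆′,u₂⟩, ⟨v₇′,u₂⟩, ⟨v₈′,u₂⟩} = ⟨v₈′,u₂⟩ = (c₂+ℓ₂)(ℓ₁(c₃+ℓ₃) − c₁(c₃−3ℓ₃)); and (ii) if moreover c₃/ℓ₃ < 1, then max{−⟨v₅′,u₂⟩, −⟨v₆′,u₂⟩, −⟨v₇′,u₂⟩, −⟨v₈′,u₂⟩} = −⟨v₇′,u₂⟩ = (c₁−ℓ₁)(c₂+ℓ₂)(c₃−3ℓ₃). -/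
theorem lemma_z2 (c₁ c₂ c₃ ℓ₁ ℓ₂ ℓ₃ : ℝ)
    (hc₁ : 0 ≤ c₁) (hc₂ : 0 ≤ c₂) (hc₃ : 0 ≤ c₃)
    (hℓ₁ : 0 < ℓ₁) (hℓ₂ : 0 < ℓ₂) (hℓ₃ : 0 < ℓ₃)
    (hΩ₁ : c₁ / ℓ₁ ≤ c₂ / ℓ₂) (hΩ₂ : c₂ / ℓ₂ ≤ c₃ / ℓ₃)
    (v₅ v₆ v₇ v₈ : Fin 3 → ℝ)
    (hv₅ : v₅ = ![(c₁ - ℓ₁) * (c₂ - ℓ₂) * (c₃ + ℓ₃), c₁ - ℓ₁, c₂ - ℓ₂])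
    (hv₆ : v₆ = ![(c₁ + ℓ₁) * (c₂ - ℓ₂) * (c₃ + ℓ₃), c₁ + ℓ₁, c₂ - ℓ₂])
    (hv₇ : v₇ = ![(c₁ - ℓ₁) * (c₂ + ℓ₂) * (c₃ + ℓ₃), c₁ - ℓ₁, c₂ + ℓ₂])
    (hv₈ : v₈ = ![(c₁ + ℓ₁) * (c₂ + ℓ₂) * (c₃ + ℓ₃), c₁ + ℓ₁, c₂ + ℓ₂])
    (u₂ : Fin 3 → ℝ)
    (hu₂ : u₂ = ![1, -((c₂ + ℓ₂) * (c₃ - ℓ₃)), -((c₁ - ℓ₁) * (c₃ - ℓ₃))]) :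
    (max (max (dot3 v₅ u₂) (dot3 v₆ u₂)) (max (dot3 v₇ u₂) (dot3 v₈ u₂)) = dot3 v₈ u₂ ∧
      dot3 v₈ u₂ = (c₂ + ℓ₂) * (ℓ₁ * (c₃ + ℓ₃) - c₁ * (c₃ - 3 * ℓ₃))) ∧
    (c₃ / ℓ₃ < 1 →
      max (max (-dot3 v₅ u₂) (-dot3 v₆ u₂)) (max (-dot3 v₇ u₂) (-dot3 v₈ u₂)) =
        -dot3 v₇ u₂ ∧
      -dot3 v₇ u₂ = (c₁ - ℓ₁) * (c₂ + ℓ₂) * (c₃ - 3 * ℓ₃)) := by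
  have hdot : ∀ a b c d e f : ℝ, dot3 ![a, b, c] ![d, e, f] = a * d + b * e + c * f := by
    intro a b c d e f
    simp [dot3, Fin.sum_univ_three]
  rw [div_le_div_iff₀ hℓ₁ hℓ₂] at hΩ₁
  subst hv₅ hv₆ hv₇ hv₈ hu₂
  simp only [hdot]
  refine ⟨⟨?_, by ring⟩, fun h => ⟨?_, by ring⟩⟩
  · have h₁₂ : 0 ≤ ℓ₃ * (ℓ₁ * c₂ + ℓ₂ * c₁) := by positivity
    have h₁₃ : 0 ≤ ℓ₂ * (c₁ * ℓ₃ + ℓ₁ * c₃) := by positivity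
    have h₂₃ : 0 ≤ ℓ₁ * ℓ₃ * (c₂ + ℓ₂) := by positivity
    refine le_antisymm (max_le (max_le ?_ ?_) (max_le ?_ le_rfl))
      (le_max_of_le_right (le_max_right _ _)) <;> linarith
  · rw [div_lt_one hℓ₃] at h
    have hc₁ℓ₁ : c₁ ≤ ℓ₁ := by
      have hc₂ℓ₂ : c₂ ≤ ℓ₂ := by
        rw [div_le_div_iff₀ hℓ₂ hℓ₃] at hΩ₂
        nlinarith
      nlinarith
    have h₁ : 0 ≤ ℓ₂ * ℓ₃ * (ℓ₁ - c₁) := mul_nonneg (by positivity) (by linarith)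
    have h₂ : 0 ≤ ℓ₃ * (c₂ * ℓ₁ - c₁ * ℓ₂) := mul_nonneg hℓ₃.le (by linarith)
    have h₃ : 0 ≤ ℓ₁ * ℓ₂ * (ℓ₃ - c₃) := mul_nonneg (by positivity) (by linarith)
    have h₄ : 0 ≤ ℓ₁ * ℓ₃ * (c₂ + ℓ₂) := by positivity
    refine le_antisymm (max_le (max_le ?_ ?_) (max_le le_rfl ?_))
      (le_max_of_le_right (le_max_left _ _)) <;> linarith
end

section
/- Assume cᵢ ≥ 0 and ℓᵢ > 0 for i = 1,2,3 and the ordering condition (Ω′). Let u₃ = (−1, (c₂+ℓ₂)(c₃−ℓ₃), (c₁+ℓ₁)(c₃−ℓ₃)) ∈ ℝ³. Then (i) max{⟨v₅′,u₃⟩, ⟨v₆′,u₃⟩, ⟨v₇′,u₃⟩, ⟨v₈′,u₃⟩} = ⟨v₇′,u₃⟩ = (c₂+ℓ₂)(ℓ₁(c₃+ℓ₃) + c₁(c₃−3ℓ₃)); and (ii) if moreover c₃/ℓ₃ < 1, then max{−⟨v₅′,u₃⟩, −⟨v₆′,u₃⟩, −⟨v₇′,u₃⟩, −⟨v₈′,u₃⟩}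 = −⟨v₈′,u₃⟩ = −(c₁+ℓ₁)(c₂+ℓ₂)(c₃−3ℓ₃). -/
theorem lemma_z3 (c₁ c₂ c₃ ℓ₁ ℓ₂ ℓ₃ : ℝ)
    (hc₁ : 0 ≤ c₁) (hc₂ : 0 ≤ c₂) (hc₃ : 0 ≤ c₃)
    (hℓ₁ : 0 < ℓ₁) (hℓ₂ : 0 < ℓ₂) (hℓ₃ : 0 < ℓ₃)
    (hΩ₁ : c₁ / ℓ₁ ≤ c₂ / ℓ₂) (hΩ₂ : c₂ / ℓ₂ ≤ c₃ / ℓ₃)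
    (v₅ v₆ v₇ v₈ : Fin 3 → ℝ)
    (hv₅ : v₅ = ![(c₁ - ℓ₁) * (c₂ - ℓ₂) * (c₃ + ℓ₃), c₁ - ℓ₁, c₂ - ℓ₂])
    (hv₆ : v₆ = ![(c₁ + ℓ₁) * (c₂ - ℓ₂) * (c₃ + ℓ₃), c₁ + ℓ₁, c₂ - ℓ₂])
    (hv₇ : v₇ = ![(c₁ - ℓ₁) * (c₂ + ℓ₂) * (c₃ + ℓ₃), c₁ - ℓ₁, c₂ + ℓ₂])
    (hv₈ : v₈ = ![(c₁ + ℓ₁) * (c₂ + ℓ₂) * (c₃ + ℓ₃), c₁ + ℓ₁, c₂ + ℓ₂])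
    (u₃ : Fin 3 → ℝ)
    (hu₃ : u₃ = ![-1, (c₂ + ℓ₂) * (c₃ - ℓ₃), (c₁ + ℓ₁) * (c₃ - ℓ₃)]) :
    (max (max (dot3 v₅ u₃) (dot3 v₆ u₃)) (max (dot3 v₇ u₃) (dot3 v₈ u₃)) = dot3 v₇ u₃ ∧
      dot3 v₇ u₃ = (c₂ + ℓ₂) * (ℓ₁ * (c₃ + ℓ₃) + c₁ * (c₃ - 3 * ℓ₃))) ∧
    (c₃ / ℓ₃ < 1 →
      max (max (-dot3 v₅ u₃) (-dot3 v₆ u₃)) (max (-dot3 v₇ u₃) (-dot3 v₈ u₃)) =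
        -dot3 v₈ u₃ ∧
      -dot3 v₈ u₃ = -((c₁ + ℓ₁) * (c₂ + ℓ₂) * (c₃ - 3 * ℓ₃))) := by
  have h₁₂ : 0 ≤ c₂ * ℓ₁ - c₁ * ℓ₂ := by
    rw [div_le_div_iff₀ hℓ₁ hℓ₂] at hΩ₁
    linarith
  have h₁₃ : 0 ≤ c₃ * ℓ₁ - c₁ * ℓ₃ := by
    have h := hΩ₁.trans hΩ₂
    rw [div_le_div_iff₀ hℓ₁ hℓ₃] at h
    linarith
  have e₅ : dot3 v₇ u₃ - dot3 v₅ u₃ = 4 * (ℓ₂ * (c₃ * ℓ₁ - c₁ * ℓ₃)) := by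
    simp [dot3, Fin.sum_univ_three, hv₅, hv₇, hu₃]
    ring
  have e₆ : dot3 v₇ u₃ - dot3 v₆ u₃ = 4 * (ℓ₃ * (c₂ * ℓ₁ - c₁ * ℓ₂)) := by
    simp [dot3, Fin.sum_univ_three, hv₆, hv₇, hu₃]
    ring
  have e₇ : dot3 v₇ u₃ = (c₂ + ℓ₂) * (ℓ₁ * (c₃ + ℓ₃) + c₁ * (c₃ - 3 * ℓ₃)) := by
    simp [dot3, Fin.sum_univ_three, hv₇, hu₃]
    ring
  have e₈ : dot3 v₈ u₃ = (c₁ + ℓ₁) * (c₂ + ℓ₂) * (c₃ - 3 * ℓ₃) := by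
    simp [dot3, Fin.sum_univ_three, hv₈, hu₃]
    ring
  have h₅₇ : dot3 v₅ u₃ ≤ dot3 v₇ u₃ := by
    rw [← sub_nonneg, e₅]
    positivity
  have h₆₇ : dot3 v₆ u₃ ≤ dot3 v₇ u₃ := by
    rw [← sub_nonneg, e₆]
    positivity
  have h₈₇ : dot3 v₈ u₃ ≤ dot3 v₇ u₃ := by
    have h : dot3 v₇ u₃ - dot3 v₈ u₃ = 4 * ℓ₁ * ℓ₃ * (c₂ + ℓ₂) := by
      rw [e₇, e₈]
      ring
    rw [← sub_nonneg, h]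
    positivity
  refine ⟨⟨?_, e₇⟩, fun hlt => ⟨?_, by rw [e₈]⟩⟩
  · rw [max_eq_left h₈₇, max_eq_right (max_le h₅₇ h₆₇)]
  · have hd : 0 ≤ ℓ₃ - c₃ := by
      rw [div_lt_one hℓ₃] at hlt
      linarith
    have h₈₅ : dot3 v₈ u₃ ≤ dot3 v₅ u₃ := by
      have h : dot3 v₅ u₃ - dot3 v₈ u₃ =
          4 * (ℓ₁ * ℓ₃ * c₂ + ℓ₁ * ℓ₂ * (ℓ₃ - c₃) + ℓ₂ * c₁ * ℓ₃) := by
        linear_combination e₇ - e₈ - e₅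
      rw [← sub_nonneg, h]
      positivity
    have h₈₆ : dot3 v₈ u₃ ≤ dot3 v₆ u₃ := by
      have h : dot3 v₆ u₃ - dot3 v₈ u₃ = 4 * ℓ₂ * ℓ₃ * (c₁ + ℓ₁) := by
        linear_combination e₇ - e₈ - e₆
      rw [← sub_nonneg, h]
      positivity
    rw [max_eq_right (neg_le_neg h₈₇),
      max_eq_right (max_le (neg_le_neg h₈₅) (neg_le_neg h₈₆))]
end

section
/- Assume cᵢ ≥ 0 and ℓᵢ > 0 for i = 1,2,3 and the ordering condition (Ω′). Let u₄ = (−1, (c₂−ℓ₂)(c₃−ℓ₃), (c₁−ℓ₁)(c₃−ℓ₃)) ∈ ℝ³. Then (i) max{⟨v₅′,u₄⟩, ⟨v₆′,u₄⟩, ⟨v₇′,u₄⟩, ⟨v₈′,u₄⟩} equals ⟨v₅′,u₄⟩ = (c₁−ℓ₁)(c₂−ℓ₂)(c₃−3ℓ₃) if c₁/ℓ₁ ≥ 1, and equals ⟨v₇′,u₄⟩ if c₁/ℓ₁ < 1; and (ii) max{−⟨v₅′,u₄⟩, −⟨v₆′,u₄⟩, −⟨v₇′,u₄⟩, −⟨v₈′,u₄⟩}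 equals −⟨v₈′,u₄⟩ if c₁/ℓ₁ + c₂/ℓ₂ + c₃/ℓ₃ ≥ 1, and equals −⟨v₅′,u₄⟩ if c₁/ℓ₁ + c₂/ℓ₂ + c₃/ℓ₃ < 1. -/
theorem lemma_z4 (c₁ c₂ c₃ ℓ₁ ℓ₂ ℓ₃ : ℝ)
    (hc₁ : 0 ≤ c₁) (hc₂ : 0 ≤ c₂) (hc₃ : 0 ≤ c₃)
    (hℓ₁ : 0 < ℓ₁) (hℓ₂ : 0 < ℓ₂) (hℓ₃ : 0 < ℓ₃)
    (hΩ₁ : c₁ / ℓ₁ ≤ c₂ / ℓ₂) (hΩ₂ : c₂ / ℓ₂ ≤ c₃ / ℓ₃)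
    (v₅ v₆ v₇ v₈ : Fin 3 → ℝ)
    (hv₅ : v₅ = ![(c₁ - ℓ₁) * (c₂ - ℓ₂) * (c₃ + ℓ₃), c₁ - ℓ₁, c₂ - ℓ₂])
    (hv₆ : v₆ = ![(c₁ + ℓ₁) * (c₂ - ℓ₂) * (c₃ + ℓ₃), c₁ + ℓ₁, c₂ - ℓ₂])
    (hv₇ : v₇ = ![(c₁ - ℓ₁) * (c₂ + ℓ₂) * (c₃ + ℓ₃), c₁ - ℓ₁, c₂ + ℓ₂])
    (hv₈ : v₈ = ![(c₁ + ℓ₁) * (c₂ + ℓ₂) * (c₃ + ℓ₃), c₁ + ℓ₁, c₂ + ℓ₂])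
    (u₄ : Fin 3 → ℝ)
    (hu₄ : u₄ = ![-1, (c₂ - ℓ₂) * (c₃ - ℓ₃), (c₁ - ℓ₁) * (c₃ - ℓ₃)]) :
    (1 ≤ c₁ / ℓ₁ →
      max (max (dot3 v₅ u₄) (dot3 v₆ u₄)) (max (dot3 v₇ u₄) (dot3 v₈ u₄)) =
        dot3 v₅ u₄ ∧
      dot3 v₅ u₄ = (c₁ - ℓ₁) * (c₂ - ℓ₂) * (c₃ - 3 * ℓ₃)) ∧
    (c₁ / ℓ₁ < 1 →
      max (max (dot3 v₅ u₄) (dot3 v₆ u₄)) (max (dot3 v₇ u₄) (dot3 v₈ u₄)) =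
        dot3 v₇ u₄) ∧
    (1 ≤ c₁ / ℓ₁ + c₂ / ℓ₂ + c₃ / ℓ₃ →
      max (max (-dot3 v₅ u₄) (-dot3 v₆ u₄)) (max (-dot3 v₇ u₄) (-dot3 v₈ u₄)) =
        -dot3 v₈ u₄) ∧
    (c₁ / ℓ₁ + c₂ / ℓ₂ + c₃ / ℓ₃ < 1 →
      max (max (-dot3 v₅ u₄) (-dot3 v₆ u₄)) (max (-dot3 v₇ u₄) (-dot3 v₈ u₄)) =
        -dot3 v₅ u₄) := by
  obtain ⟨a, rfl⟩ : ∃ a, c₁ = a * ℓ₁ := ⟨c₁ / ℓ₁, by field_simp⟩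
  obtain ⟨b, rfl⟩ : ∃ b, c₂ = b * ℓ₂ := ⟨c₂ / ℓ₂, by field_simp⟩
  obtain ⟨c, rfl⟩ : ∃ c, c₃ = c * ℓ₃ := ⟨c₃ / ℓ₃, by field_simp⟩
  have ha : 0 ≤ a := nonneg_of_mul_nonneg_left hc₁ hℓ₁
  simp only [mul_div_cancel_right₀ _ hℓ₁.ne', mul_div_cancel_right₀ _ hℓ₂.ne',
    mul_div_cancel_right₀ _ hℓ₃.ne'] at *
  have hL : 0 < ℓ₁ * ℓ₂ * ℓ₃ := by positivity
  have h₅ : dot3 v₅ u₄ = (a * ℓ₁ - ℓ₁) * (b * ℓ₂ - ℓ₂) * (c * ℓ₃ - 3 * ℓ₃) := by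
    simp [dot3, Fin.sum_univ_three, hv₅, hu₄]; ring
  have h₆ : dot3 v₆ u₄ = dot3 v₅ u₄ - 4 * (ℓ₁ * ℓ₂ * ℓ₃ * (b - 1)) := by
    simp [dot3, Fin.sum_univ_three, hv₅, hv₆, hu₄]; ring
  have h₇ : dot3 v₇ u₄ = dot3 v₅ u₄ - 4 * (ℓ₁ * ℓ₂ * ℓ₃ * (a - 1)) := by
    simp [dot3, Fin.sum_univ_three, hv₅, hv₇, hu₄]; ring
  have h₈ : dot3 v₈ u₄ = dot3 v₅ u₄ - 4 * (ℓ₁ * ℓ₂ * ℓ₃ * (a + b + c - 1)) := by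
    simp [dot3, Fin.sum_univ_three, hv₅, hv₈, hu₄]; ring
  have mono {x y : ℝ} (h : x ≤ y) : ℓ₁ * ℓ₂ * ℓ₃ * x ≤ ℓ₁ * ℓ₂ * ℓ₃ * y :=
    mul_le_mul_of_nonneg_left h hL.le
  refine ⟨fun h => ⟨?_, h₅⟩, fun h => ?_, fun h => ?_, fun h => ?_⟩
  · have e₆ := mono (show 0 ≤ b - 1 by linarith)
    have e₇ := mono (show 0 ≤ a - 1 by linarith)
    have e₈ := mono (show 0 ≤ a + b + c - 1 by linarith)
    apply le_antisymm
    · simp only [max_le_iff]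
      refine ⟨⟨?_, ?_⟩, ?_, ?_⟩ <;> linarith
    · simp
  · have e₅ := mono (show a - 1 ≤ 0 by linarith)
    have e₆ := mono (show a - 1 ≤ b - 1 by linarith)
    have e₈ := mono (show a - 1 ≤ a + b + c - 1 by linarith)
    apply le_antisymm
    · simp only [max_le_iff]
      refine ⟨⟨?_, ?_⟩, ?_, ?_⟩ <;> linarith
    · simp
  · have e₅ := mono (show 0 ≤ a + b + c - 1 by linarith)
    have e₆ := mono (show b - 1 ≤ a + b + c - 1 by linarith)
    have e₇ := mono (show a - 1 ≤ a + b + c - 1 by linarith)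
    apply le_antisymm
    · simp only [max_le_iff]
      refine ⟨⟨?_, ?_⟩, ?_, ?_⟩ <;> linarith
    · simp
  · have e₆ := mono (show b - 1 ≤ 0 by linarith)
    have e₇ := mono (show a - 1 ≤ 0 by linarith)
    have e₈ := mono (show a + b + c - 1 ≤ 0 by linarith)
    apply le_antisymm
    · simp only [max_le_iff]
      refine ⟨⟨?_, ?_⟩, ?_, ?_⟩ <;> linarith
    · simp
end

section
/- Assume cᵢ ≥ 0 and ℓᵢ > 0 for i = 1,2,3 and the ordering condition (Ω′). Let u₅ = (1, −(c₂−ℓ₂)(c₃+ℓ₃), −(c₁+ℓ₁)(c₃+ℓ₃)) ∈ ℝ³. Then max{⟨v₁′,u₅⟩, ⟨v₂′,u₅⟩, ⟨v₃′,u₅⟩, ⟨v₄′,u₅⟩} equals ⟨v₁′,u₅⟩ = (c₂−ℓ₂)(ℓ₁(ℓ₃−c₃) − c₁(c₃+3ℓ₃)) if c₂/ℓ₂ ≥ 1, and equals ⟨v₂′,u₅⟩ = −(c₁+ℓ₁)(c₂−ℓ₂)(c₃+3ℓ₃) if c₂/ℓ₂ < 1. -/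
theorem lemma_z5 (c₁ c₂ c₃ ℓ₁ ℓ₂ ℓ₃ : ℝ)
    (hc₁ : 0 ≤ c₁) (hc₂ : 0 ≤ c₂) (hc₃ : 0 ≤ c₃)
    (hℓ₁ : 0 < ℓ₁) (hℓ₂ : 0 < ℓ₂) (hℓ₃ : 0 < ℓ₃)
    (v₁ v₂ v₃ v₄ : Fin 3 → ℝ)
    (hv₁ : v₁ = ![(c₁ - ℓ₁) * (c₂ - ℓ₂) * (c₃ - ℓ₃), c₁ - ℓ₁, c₂ - ℓ₂])
    (hv₂ : v₂ = ![(c₁ + ℓ₁) * (c₂ - ℓ₂) * (c₃ - ℓ₃), c₁ + ℓ₁, c₂ - ℓ₂])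
    (hv₃ : v₃ = ![(c₁ - ℓ₁) * (c₂ + ℓ₂) * (c₃ - ℓ₃), c₁ - ℓ₁, c₂ + ℓ₂])
    (hv₄ : v₄ = ![(c₁ + ℓ₁) * (c₂ + ℓ₂) * (c₃ - ℓ₃), c₁ + ℓ₁, c₂ + ℓ₂])
    (hΩ₁ : c₁ / ℓ₁ ≤ c₂ / ℓ₂) (hΩ₂ : c₂ / ℓ₂ ≤ c₃ / ℓ₃)
    (u₅ : Fin 3 → ℝ)
    (hu₅ : u₅ = ![1, -((c₂ - ℓ₂) * (c₃ + ℓ₃)), -((c₁ + ℓ₁) * (c₃ + ℓ₃))]) :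
    (1 ≤ c₂ / ℓ₂ →
      max (max (dot3 v₁ u₅) (dot3 v₂ u₅)) (max (dot3 v₃ u₅) (dot3 v₄ u₅)) =
        dot3 v₁ u₅ ∧
      dot3 v₁ u₅ = (c₂ - ℓ₂) * (ℓ₁ * (ℓ₃ - c₃) - c₁ * (c₃ + 3 * ℓ₃))) ∧
    (c₂ / ℓ₂ < 1 →
      max (max (dot3 v₁ u₅) (dot3 v₂ u₅)) (max (dot3 v₃ u₅) (dot3 v₄ u₅)) =
        dot3 v₂ u₅ ∧
      dot3 v₂ u₅ = -((c₁ + ℓ₁) * (c₂ - ℓ₂) * (c₃ + 3 * ℓ₃))) := by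
  have dot_eq (a b c x y z : ℝ) : dot3 ![a, b, c] ![x, y, z] = a * x + b * y + c * z := by
    simp [dot3, Fin.sum_univ_three]
  subst hv₁ hv₂ hv₃ hv₄ hu₅
  simp only [dot_eq]
  have h₁₃ : 0 ≤ 4 * ℓ₂ * (c₁ * ℓ₃ + ℓ₁ * c₃) := by positivity
  have h₂₄ : 0 ≤ 4 * ℓ₂ * ℓ₃ * (c₁ + ℓ₁) := by positivity
  refine ⟨fun h => ⟨?_, by ring⟩, fun h => ⟨?_, by ring⟩⟩
  · rw [one_le_div hℓ₂] at h
    have h₁₂ : 0 ≤ 4 * (ℓ₁ * ℓ₃) * (c₂ - ℓ₂) := mul_nonneg (by positivity) (by linarith)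
    exact le_antisymm
      (max_le (max_le (by linarith) (by linarith)) (max_le (by linarith) (by linarith)))
      ((le_max_left _ _).trans (le_max_left _ _))
  · rw [div_lt_one hℓ₂] at h
    have h₂₁ : 0 ≤ 4 * (ℓ₁ * ℓ₃) * (ℓ₂ - c₂) := mul_nonneg (by positivity) (by linarith)
    exact le_antisymm
      (max_le (max_le (by linarith) (by linarith)) (max_le (by linarith) (by linarith)))
      ((le_max_right _ _).trans (le_max_left _ _))
end

section
/- Assume cᵢ ≥ 0 and ℓᵢ > 0 for i = 1,2,3 and the ordering condition (Ω′). Let u₆ = (1, −(c₂+ℓ₂)(c₃+ℓ₃), −(c₁−ℓ₁)(c₃+ℓ₃)) ∈ ℝ³. Then max{⟨v₁′,u₆⟩, ⟨v₂′,u₆⟩, ⟨v₃′,u₆⟩, ⟨v₄′,u₆⟩} equals ⟨v₁′,u₆⟩ = (c₁−ℓ₁)(ℓ₂(ℓ₃−c₃) − c₂(c₃+3ℓ₃)) if c₁/ℓ₁ ≥ 1, and equals ⟨v₃′,u₆⟩ = −(c₁−ℓ₁)(c₂+ℓ₂)(c₃+3ℓ₃) if c₁/ℓ₁ < 1. -/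
theorem lemma_z6 (c₁ c₂ c₃ ℓ₁ ℓ₂ ℓ₃ : ℝ)
    (hc₁ : 0 ≤ c₁) (hc₂ : 0 ≤ c₂) (hc₃ : 0 ≤ c₃)
    (hℓ₁ : 0 < ℓ₁) (hℓ₂ : 0 < ℓ₂) (hℓ₃ : 0 < ℓ₃)
    (v₁ v₂ v₃ v₄ : Fin 3 → ℝ)
    (hv₁ : v₁ = ![(c₁ - ℓ₁) * (c₂ - ℓ₂) * (c₃ - ℓ₃), c₁ - ℓ₁, c₂ - ℓ₂])
    (hv₂ : v₂ = ![(c₁ + ℓ₁) * (c₂ - ℓ₂) * (c₃ - ℓ₃), c₁ + ℓ₁, c₂ - ℓ₂])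
    (hv₃ : v₃ = ![(c₁ - ℓ₁) * (c₂ + ℓ₂) * (c₃ - ℓ₃), c₁ - ℓ₁, c₂ + ℓ₂])
    (hv₄ : v₄ = ![(c₁ + ℓ₁) * (c₂ + ℓ₂) * (c₃ - ℓ₃), c₁ + ℓ₁, c₂ + ℓ₂])
    (hΩ₁ : c₁ / ℓ₁ ≤ c₂ / ℓ₂) (hΩ₂ : c₂ / ℓ₂ ≤ c₃ / ℓ₃)
    (u₆ : Fin 3 → ℝ)
    (hu₆ : u₆ = ![1, -((c₂ + ℓ₂) * (c₃ + ℓ₃)), -((c₁ - ℓ₁) * (c₃ + ℓ₃))]) :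
    (1 ≤ c₁ / ℓ₁ →
      max (max (dot3 v₁ u₆) (dot3 v₂ u₆)) (max (dot3 v₃ u₆) (dot3 v₄ u₆)) =
        dot3 v₁ u₆ ∧
      dot3 v₁ u₆ = (c₁ - ℓ₁) * (ℓ₂ * (ℓ₃ - c₃) - c₂ * (c₃ + 3 * ℓ₃))) ∧
    (c₁ / ℓ₁ < 1 →
      max (max (dot3 v₁ u₆) (dot3 v₂ u₆)) (max (dot3 v₃ u₆) (dot3 v₄ u₆)) =
        dot3 v₃ u₆ ∧
      dot3 v₃ u₆ = -((c₁ - ℓ₁) * (c₂ + ℓ₂) * (c₃ + 3 * ℓ₃))) := by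
  have h₂₁ : dot3 v₂ u₆ = dot3 v₁ u₆ - 4 * ℓ₁ * (c₂ * ℓ₃ + ℓ₂ * c₃) := by
    subst hv₁ hv₂ hu₆
    simp [dot3, Fin.sum_univ_three]
    ring
  have h₄₃ : dot3 v₄ u₆ = dot3 v₃ u₆ - 4 * ℓ₁ * ℓ₃ * (c₂ + ℓ₂) := by
    subst hv₃ hv₄ hu₆
    simp [dot3, Fin.sum_univ_three]
    ring
  have h₁ : dot3 v₁ u₆ = (c₁ - ℓ₁) * (ℓ₂ * (ℓ₃ - c₃) - c₂ * (c₃ + 3 * ℓ₃)) := by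
    subst hv₁ hu₆
    simp [dot3, Fin.sum_univ_three]
    ring
  have h₃ : dot3 v₃ u₆ = -((c₁ - ℓ₁) * (c₂ + ℓ₂) * (c₃ + 3 * ℓ₃)) := by
    subst hv₃ hu₆
    simp [dot3, Fin.sum_univ_three]
    ring
  have h₁₃ : dot3 v₁ u₆ - dot3 v₃ u₆ = 4 * ℓ₂ * ℓ₃ * (c₁ - ℓ₁) := by
    rw [h₁, h₃]
    ring
  have le₂₁ : dot3 v₂ u₆ ≤ dot3 v₁ u₆ := by
    rw [h₂₁]
    exact sub_le_self _ (by positivity)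
  have le₄₃ : dot3 v₄ u₆ ≤ dot3 v₃ u₆ := by
    rw [h₄₃]
    exact sub_le_self _ (by positivity)
  rw [max_eq_left le₂₁, max_eq_left le₄₃, one_le_div hℓ₁, div_lt_one hℓ₁]
  refine ⟨fun h => ⟨max_eq_left ?_, h₁⟩, fun h => ⟨max_eq_right ?_, h₃⟩⟩
  · rw [← sub_nonneg, h₁₃]
    exact mul_nonneg (by positivity) (sub_nonneg.2 h)
  · rw [← sub_nonpos, h₁₃]
    exact mul_nonpos_of_nonneg_of_nonpos (by positivity) (sub_nonpos.2 h.le)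
end

section
/- Assume cᵢ ≥ 0 and ℓᵢ > 0 for i = 1,2,3. Let u₇ = (−1, (c₂+ℓ₂)(c₃+ℓ₃), (c₁+ℓ₁)(c₃+ℓ₃)) ∈ ℝ³. Then max{⟨v₁′,u₇⟩, ⟨v₂′,u₇⟩, ⟨v₃′,u₇⟩, ⟨v₄′,u₇⟩} = ⟨v₄′,u₇⟩ = (c₁+ℓ₁)(c₂+ℓ₂)(c₃+3ℓ₃). -/
theorem lemma_z7 (c₁ c₂ c₃ ℓ₁ ℓ₂ ℓ₃ : ℝ)
    (hc₁ : 0 ≤ c₁) (hc₂ : 0 ≤ c₂) (hc₃ : 0 ≤ c₃)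
    (hℓ₁ : 0 < ℓ₁) (hℓ₂ : 0 < ℓ₂) (hℓ₃ : 0 < ℓ₃)
    (v₁ v₂ v₃ v₄ : Fin 3 → ℝ)
    (hv₁ : v₁ = ![(c₁ - ℓ₁) * (c₂ - ℓ₂) * (c₃ - ℓ₃), c₁ - ℓ₁, c₂ - ℓ₂])
    (hv₂ : v₂ = ![(c₁ + ℓ₁) * (c₂ - ℓ₂) * (c₃ - ℓ₃), c₁ + ℓ₁, c₂ - ℓ₂])
    (hv₃ : v₃ = ![(c₁ - ℓ₁) * (c₂ + ℓ₂) * (c₃ - ℓ₃), c₁ - ℓ₁, c₂ + ℓ₂])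
    (hv₄ : v₄ = ![(c₁ + ℓ₁) * (c₂ + ℓ₂) * (c₃ - ℓ₃), c₁ + ℓ₁, c₂ + ℓ₂])
    (u₇ : Fin 3 → ℝ)
    (hu₇ : u₇ = ![-1, (c₂ + ℓ₂) * (c₃ + ℓ₃), (c₁ + ℓ₁) * (c₃ + ℓ₃)]) :
    max (max (dot3 v₁ u₇) (dot3 v₂ u₇)) (max (dot3 v₃ u₇) (dot3 v₄ u₇)) =
      dot3 v₄ u₇ ∧
    dot3 v₄ u₇ = (c₁ + ℓ₁) * (c₂ + ℓ₂) * (c₃ + 3 * ℓ₃) := by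
  subst hv₁ hv₂ hv₃ hv₄ hu₇
  simp only [dot3, Fin.sum_univ_three, Matrix.cons_val]
  refine ⟨max_eq_right ?_ |>.trans (max_eq_right ?_), by ring⟩
  · refine le_trans (max_le ?_ ?_) (le_max_right _ _)
    · have h : 0 ≤ 4 * ((c₂ + ℓ₂) * ℓ₁ * ℓ₃ + ℓ₂ * (c₁ * ℓ₃ + c₃ * ℓ₁)) := by positivity
      linarith
    · have h : 0 ≤ 4 * ((c₁ + ℓ₁) * ℓ₂ * ℓ₃) := by positivity
      linarith
  · have h : 0 ≤ 4 * ((c₂ + ℓ₂) * ℓ₁ * ℓ₃) := by positivity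
    linarith
end

section
/- Assume cᵢ ≥ 0 and ℓᵢ > 0 for i = 1,2,3 and the ordering condition (Ω′). Let u₈ = (−1, (c₂−ℓ₂)(c₃+ℓ₃), (c₁−ℓ₁)(c₃+ℓ₃)) ∈ ℝ³. Then max{⟨v₁′,u₈⟩, ⟨v₂′,u₈⟩, ⟨v₃′,u₈⟩, ⟨v₄′,u₈⟩} equals ⟨v₂′,u₈⟩ = (c₂−ℓ₂)(ℓ₁(ℓ₃−c₃) + c₁(c₃+3ℓ₃)) if c₂/ℓ₂ ≥ 1, and equals ⟨v₁′,u₈⟩ = (c₁−ℓ₁)(c₂−ℓ₂)(c₃+3ℓ₃) if c₂/ℓ₂ < 1. -/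
theorem lemma_z8 (c₁ c₂ c₃ ℓ₁ ℓ₂ ℓ₃ : ℝ)
    (hc₁ : 0 ≤ c₁) (hc₂ : 0 ≤ c₂) (hc₃ : 0 ≤ c₃)
    (hℓ₁ : 0 < ℓ₁) (hℓ₂ : 0 < ℓ₂) (hℓ₃ : 0 < ℓ₃)
    (v₁ v₂ v₃ v₄ : Fin 3 → ℝ)
    (hv₁ : v₁ = ![(c₁ - ℓ₁) * (c₂ - ℓ₂) * (c₃ - ℓ₃), c₁ - ℓ₁, c₂ - ℓ₂])
    (hv₂ : v₂ = ![(c₁ + ℓ₁) * (c₂ - ℓ₂) * (c₃ - ℓ₃), c₁ + ℓ₁, c₂ - ℓ₂])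
    (hv₃ : v₃ = ![(c₁ - ℓ₁) * (c₂ + ℓ₂) * (c₃ - ℓ₃), c₁ - ℓ₁, c₂ + ℓ₂])
    (hv₄ : v₄ = ![(c₁ + ℓ₁) * (c₂ + ℓ₂) * (c₃ - ℓ₃), c₁ + ℓ₁, c₂ + ℓ₂])
    (hΩ₁ : c₁ / ℓ₁ ≤ c₂ / ℓ₂) (hΩ₂ : c₂ / ℓ₂ ≤ c₃ / ℓ₃)
    (u₈ : Fin 3 → ℝ)
    (hu₈ : u₈ = ![-1, (c₂ - ℓ₂) * (c₃ + ℓ₃), (c₁ - ℓ₁) * (c₃ + ℓ₃)]) :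
    (1 ≤ c₂ / ℓ₂ →
      max (max (dot3 v₁ u₈) (dot3 v₂ u₈)) (max (dot3 v₃ u₈) (dot3 v₄ u₈)) =
        dot3 v₂ u₈ ∧
      dot3 v₂ u₈ = (c₂ - ℓ₂) * (ℓ₁ * (ℓ₃ - c₃) + c₁ * (c₃ + 3 * ℓ₃))) ∧
    (c₂ / ℓ₂ < 1 →
      max (max (dot3 v₁ u₈) (dot3 v₂ u₈)) (max (dot3 v₃ u₈) (dot3 v₄ u₈)) =
        dot3 v₁ u₈ ∧
      dot3 v₁ u₈ = (c₁ - ℓ₁) * (c₂ - ℓ₂) * (c₃ + 3 * ℓ₃)) := by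
  rw [div_le_div_iff₀ hℓ₁ hℓ₂] at hΩ₁
  rw [div_le_div_iff₀ hℓ₂ hℓ₃] at hΩ₂
  have hΩ₁₃ : c₁ * ℓ₃ ≤ c₃ * ℓ₁ := by
    refine le_of_mul_le_mul_right ?_ hℓ₂
    linarith [mul_le_mul_of_nonneg_right hΩ₁ hℓ₃.le, mul_le_mul_of_nonneg_right hΩ₂ hℓ₁.le]
  have h₂₁ : dot3 v₂ u₈ - dot3 v₁ u₈ = 4 * (ℓ₁ * ℓ₃) * (c₂ - ℓ₂) := by
    simp [dot3, Fin.sum_univ_three, hv₁, hv₂, hu₈]; ring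
  have h₂₃ : dot3 v₂ u₈ - dot3 v₃ u₈ = 4 * ℓ₃ * (c₂ * ℓ₁ - c₁ * ℓ₂) := by
    simp [dot3, Fin.sum_univ_three, hv₂, hv₃, hu₈]; ring
  have h₂₄ : dot3 v₂ u₈ - dot3 v₄ u₈ = 4 * ℓ₂ * (c₃ * ℓ₁ - c₁ * ℓ₃) := by
    simp [dot3, Fin.sum_univ_three, hv₂, hv₄, hu₈]; ring
  have h₂₃_nonneg := mul_nonneg (by positivity : 0 ≤ 4 * ℓ₃) (sub_nonneg.2 hΩ₁)
  have h₂₄_nonneg := mul_nonneg (by positivity : 0 ≤ 4 * ℓ₂) (sub_nonneg.2 hΩ₁₃)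
  refine ⟨fun h => ⟨?_, ?_⟩, fun h => ⟨?_, ?_⟩⟩
  · rw [one_le_div hℓ₂] at h
    have h₂₁_nonneg := mul_nonneg (by positivity : 0 ≤ 4 * (ℓ₁ * ℓ₃)) (sub_nonneg.2 h)
    rw [max_eq_right (by linarith : dot3 v₁ u₈ ≤ dot3 v₂ u₈)]
    exact max_eq_left (max_le (by linarith) (by linarith))
  · simp [dot3, Fin.sum_univ_three, hv₂, hu₈]; ring
  · rw [div_lt_one hℓ₂] at h
    have h₁₂_nonneg := mul_nonneg (by positivity : 0 ≤ 4 * (ℓ₁ * ℓ₃)) (sub_nonneg.2 h.le)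
    have hc₁_le : c₁ ≤ ℓ₁ := by
      refine le_of_mul_le_mul_right ?_ hℓ₂
      linarith [mul_le_mul_of_nonneg_right h.le hℓ₁.le]
    have h₁₃_nonneg := mul_nonneg (by positivity : 0 ≤ 4 * (ℓ₂ * ℓ₃)) (sub_nonneg.2 hc₁_le)
    have h₁₄_nonneg := mul_nonneg (by positivity : 0 ≤ 4 * ℓ₁) (sub_nonneg.2 hΩ₂)
    rw [max_eq_left (by linarith : dot3 v₂ u₈ ≤ dot3 v₁ u₈)]
    exact max_eq_left (max_le (by linarith) (by linarith))
  · simp [dot3, Fin.sum_univ_three, hv₁, hu₈]; ring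
end
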